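/- For γ ∈ Γ′ the subset vδγ + Lδγ of F^r depends only on the coset Γγ, and for k ∈ K′_p the subset vδk + (L_pδ)k of F_p^r depends only on the coset K_pk. For x ∈ F^r let C(x) be the number of cosets Γγ ∈ Γ∖Γ′ with x ∈ vδγ + Lδγ, and for each nonzero prime p of A let C_p(x) be the number of cosets K_pk ∈ K_p∖K′_p with x ∈ vδk + (L_pδ)k. Then each C_p(x) is finite, C_p(x) = 1 for all but finitely many p, C(x) is finite, and C(x) = ∏_p C_p(x). (Lemma 14.4.) -/

import Mathlib

open scoped BigOperators
open IsDedekindDomain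

/-- The coset `v + L`. -/
def cosetOf {G : Type*} [AddGroup G] (v : G) (L : Set G) : Set G := {x | x - v ∈ L}

/-- The stabilizer condition of a set of row vectors under right multiplication. -/
def StabSet {Q : Type*} [Field Q] {r : ℕ} (S : Set (Fin r → Q)) (k : GL (Fin r) Q) : Prop :=
  (fun x => Matrix.vecMul x (k : Matrix (Fin r) (Fin r) Q)) '' S = S

section

variable (R₀ : Type*) [CommRing R₀] [IsDomain R₀] [IsDedekindDomain R₀]
  (F : Type*) [Field F] [Algebra R₀ F] [IsFractionRing R₀ F]

/-- The embedding of a vector of `F^r` into `F_p^r`. -/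
noncomputable def embVec (p : HeightOneSpectrum R₀) {r : ℕ} (x : Fin r → F) :
    Fin r → p.adicCompletion F :=
  fun i => algebraMap F (p.adicCompletion F) (x i)

/-- `M_p`: the topological closure of the image of `M ⊆ F^r` in `F_p^r`. -/
noncomputable def locCl (p : HeightOneSpectrum R₀) {r : ℕ} (M : Set (Fin r → F)) :
    Set (Fin r → p.adicCompletion F) :=
  closure ((fun x => embVec R₀ F p x) '' M)

/-- `𝔪_p·S`: the additive group generated by the products of elements of the maximal
ideal of the valuation ring of `F_p` with elements of `S`. -/
def mIdealSMul (p : HeightOneSpectrum R₀) {r : ℕ}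
    (S : Set (Fin r → p.adicCompletion F)) : Set (Fin r → p.adicCompletion F) :=
  (AddSubgroup.closure {y | ∃ c : p.adicCompletion F,
    Valued.v c < (1 : WithZero (Multiplicative ℤ)) ∧ ∃ x ∈ S, y = fun i => c * x i} :
    AddSubgroup (Fin r → p.adicCompletion F))

/-- The entrywise embedding `GL_r(F) → GL_r(F_p)`. -/
noncomputable def embGL (p : HeightOneSpectrum R₀) {r : ℕ} (γ : GL (Fin r) F) :
    GL (Fin r) (p.adicCompletion F) :=
  Units.map ((algebraMap F (p.adicCompletion F)).mapMatrix.toMonoidHom) γ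

end

/-- `vδ + Mδ`: the image of the coset `v + M` under right multiplication by `δ`. -/
def imDelta {Q : Type*} [Field Q] {r : ℕ} (v : Fin r → Q) (M : Set (Fin r → Q))
    (δ : GL (Fin r) Q) : Set (Fin r → Q) :=
  (fun x => Matrix.vecMul x (δ : Matrix (Fin r) (Fin r) Q)) '' cosetOf v M

/-- Membership in the stabilizer `K` of both `v′+M′` and `vδ+Mδ`. -/
def KPred {Q : Type*} [Field Q] {r : ℕ} (v v' : Fin r → Q) (M M' : Set (Fin r → Q))
    (δ : GL (Fin r) Q) (k : GL (Fin r) Q) : Prop :=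
  StabSet (cosetOf v' M') k ∧ StabSet (imDelta v M δ) k

/-- The right coset `K·k`. -/
def rCosetK {Q : Type*} [Field Q] {r : ℕ} (v v' : Fin r → Q) (M M' : Set (Fin r → Q))
    (δ : GL (Fin r) Q) (k : GL (Fin r) Q) : Set (GL (Fin r) Q) :=
  {h | ∃ g, KPred v v' M M' δ g ∧ h = g * k}

/-- The set of cosets `K·k ⊆ K′` such that `x ∈ vδk + Mδk`. -/
def countSet {Q : Type*} [Field Q] {r : ℕ} (v v' : Fin r → Q) (M M' : Set (Fin r → Q))
    (δ : GL (Fin r) Q) (x : Fin r → Q) : Set (Set (GL (Fin r) Q)) :=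
  {S | ∃ k, StabSet (cosetOf v' M') k ∧ S = rCosetK v v' M M' δ k ∧
    x ∈ (fun y => Matrix.vecMul y (k : Matrix (Fin r) (Fin r) Q)) '' imDelta v M δ}

section GeneralField

variable {Q : Type*} [Field Q] {r : ℕ}

/-- The image of a set of row vectors under right multiplication by `k`. -/
def mulGL (S : Set (Fin r → Q)) (k : GL (Fin r) Q) : Set (Fin r → Q) :=
  (fun x => Matrix.vecMul x (k : Matrix (Fin r) (Fin r) Q)) '' S

theorem mulGL_mul (S : Set (Fin r → Q)) (a b : GL (Fin r) Q) :
    mulGL S (a * b) = mulGL (mulGL S a) b := by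
  simp [mulGL, Set.image_image, Matrix.vecMul_vecMul]

theorem mulGL_one (S : Set (Fin r → Q)) : mulGL S 1 = S := by
  simp [mulGL]

theorem mulGL_mul_inv (S : Set (Fin r → Q)) (a : GL (Fin r) Q) :
    mulGL (mulGL S a) a⁻¹ = S := by
  rw [← mulGL_mul, mul_inv_cancel, mulGL_one]

theorem mulGL_mono {S S' : Set (Fin r → Q)} (h : S ⊆ S') (a : GL (Fin r) Q) :
    mulGL S a ⊆ mulGL S' a :=
  Set.image_mono h

theorem mem_mulGL_iff {S : Set (Fin r → Q)} {a : GL (Fin r) Q} {x : Fin r → Q} :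
    x ∈ mulGL S a ↔ Matrix.vecMul x ((a⁻¹ : GL (Fin r) Q) : Matrix (Fin r) (Fin r) Q) ∈ S := by
  constructor
  · rintro ⟨y, hy, rfl⟩
    simpa [Matrix.vecMul_vecMul] using hy
  · intro h
    refine ⟨_, h, ?_⟩
    simp [Matrix.vecMul_vecMul]

theorem mulGL_eq_of_subset {S : Set (Fin r → Q)} {a : GL (Fin r) Q}
    (h : mulGL S a ⊆ S) (h' : mulGL S a⁻¹ ⊆ S) : mulGL S a = S := by
  refine h.antisymm ?_
  have := mulGL_mono h' a
  rwa [← mulGL_mul, inv_mul_cancel, mulGL_one] at this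

theorem mulGL_inv_eq {S : Set (Fin r → Q)} {a : GL (Fin r) Q} (h : mulGL S a = S) :
    mulGL S a⁻¹ = S := by
  conv_lhs => rw [← h]
  exact mulGL_mul_inv S a

/-- The translates `X k` of `X` by elements `k` of the stabilizer of `X'` that contain `x`. -/
def orbSet (X X' : Set (Fin r → Q)) (x : Fin r → Q) : Set (Set (Fin r → Q)) :=
  {Z | ∃ k, mulGL X' k = X' ∧ Z = mulGL X k ∧ x ∈ Z}

theorem rCosetK_eq (v v' : Fin r → Q) (M M' : Set (Fin r → Q)) (δ k : GL (Fin r) Q)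
    (hk : mulGL (cosetOf v' M') k = cosetOf v' M') :
    rCosetK v v' M M' δ k = {h | mulGL (cosetOf v' M') h = cosetOf v' M' ∧
      mulGL (imDelta v M δ) h = mulGL (imDelta v M δ) k} := by
  ext h
  constructor
  · rintro ⟨g, ⟨hg', hg⟩, rfl⟩
    change mulGL _ g = _ at hg
    change mulGL _ g = _ at hg'
    exact ⟨by rw [mulGL_mul, hg', hk], by rw [mulGL_mul, hg]⟩
  · rintro ⟨h1, h2⟩
    refine ⟨h * k⁻¹, ⟨?_, ?_⟩, by group⟩
    · change mulGL _ _ = _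
      rw [mulGL_mul, h1, mulGL_inv_eq hk]
    · change mulGL _ _ = _
      rw [mulGL_mul, h2, mulGL_mul_inv]

theorem countSet_eq_image (v v' : Fin r → Q) (M M' : Set (Fin r → Q)) (δ : GL (Fin r) Q)
    (x : Fin r → Q) :
    countSet v v' M M' δ x = (fun Z => {h | mulGL (cosetOf v' M') h = cosetOf v' M' ∧
      mulGL (imDelta v M δ) h = Z}) '' orbSet (imDelta v M δ) (cosetOf v' M') x := by
  ext S
  constructor
  · rintro ⟨k, hk, rfl, hx⟩
    exact ⟨_, ⟨k, hk, rfl, hx⟩, (rCosetK_eq v v' M M' δ k hk).symm⟩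
  · rintro ⟨_, ⟨k, hk, rfl, hx⟩, rfl⟩
    exact ⟨k, hk, (rCosetK_eq v v' M M' δ k hk).symm, hx⟩

theorem injOn_orbSet (X X' : Set (Fin r → Q)) (x : Fin r → Q) :
    Set.InjOn (fun Z => {h : GL (Fin r) Q | mulGL X' h = X' ∧ mulGL X h = Z})
      (orbSet X X' x) := by
  rintro _ ⟨k, hk, rfl, -⟩ Z - h
  have h' : {h : GL (Fin r) Q | mulGL X' h = X' ∧ mulGL X h = mulGL X k} =
    {h : GL (Fin r) Q | mulGL X' h = X' ∧ mulGL X h = Z} := h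
  have : k ∈ {h : GL (Fin r) Q | mulGL X' h = X' ∧ mulGL X h = Z} := by
    rw [← h']
    exact ⟨hk, rfl⟩
  exact this.2

theorem finite_countSet_iff (v v' : Fin r → Q) (M M' : Set (Fin r → Q)) (δ : GL (Fin r) Q)
    (x : Fin r → Q) :
    (countSet v v' M M' δ x).Finite ↔ (orbSet (imDelta v M δ) (cosetOf v' M') x).Finite := by
  rw [countSet_eq_image]
  exact Set.finite_image_iff (injOn_orbSet _ _ x)

theorem card_countSet (v v' : Fin r → Q) (M M' : Set (Fin r → Q)) (δ : GL (Fin r) Q)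
    (x : Fin r → Q) :
    Nat.card (countSet v v' M M' δ x) =
      Nat.card (orbSet (imDelta v M δ) (cosetOf v' M') x) := by
  rw [countSet_eq_image]
  exact Nat.card_image_of_injOn (injOn_orbSet _ _ x)

end GeneralField

section AffineLattice

variable {Q : Type*} [Field Q] {r : ℕ} (O : ValuationSubring Q)

/-- The coset `c + O^r h`. -/
def affLat (c : Fin r → Q) (h : GL (Fin r) Q) : Set (Fin r → Q) :=
  {z | ∀ i, Matrix.vecMul (z - c) ((h⁻¹ : GL (Fin r) Q) : Matrix (Fin r) (Fin r) Q) i ∈ O}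

variable {O}

theorem vecMul_mem {y : Fin r → Q} {m : Matrix (Fin r) (Fin r) Q} (hy : ∀ i, y i ∈ O)
    (hm : ∀ i j, m i j ∈ O) (j : Fin r) : Matrix.vecMul y m j ∈ O := by
  simp only [Matrix.vecMul, dotProduct]
  exact sum_mem fun i _ => mul_mem (hy i) (hm i j)

theorem mem_affLat_self (c : Fin r → Q) (h : GL (Fin r) Q) : c ∈ affLat O c h := by
  intro i
  simp

theorem mulGL_affLat (c : Fin r → Q) (h k : GL (Fin r) Q) :
    mulGL (affLat O c h) k =
      affLat O (Matrix.vecMul c (k : Matrix (Fin r) (Fin r) Q)) (h * k) := by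
  ext z
  rw [mem_mulGL_iff]
  have : Matrix.vecMul (z - Matrix.vecMul c (k : Matrix (Fin r) (Fin r) Q))
      (((h * k)⁻¹ : GL (Fin r) Q) : Matrix (Fin r) (Fin r) Q) =
      Matrix.vecMul (Matrix.vecMul z ((k⁻¹ : GL (Fin r) Q) : Matrix (Fin r) (Fin r) Q) - c)
        ((h⁻¹ : GL (Fin r) Q) : Matrix (Fin r) (Fin r) Q) := by
    rw [mul_inv_rev, Units.val_mul, ← Matrix.vecMul_vecMul, Matrix.sub_vecMul (k⁻¹).1 z,
      Matrix.vecMul_vecMul c, ← Units.val_mul, mul_inv_cancel, Units.val_one, Matrix.vecMul_one]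
  simp only [affLat, Set.mem_ofPred_eq, this]

theorem affLat_eq_of_mem {c c' : Fin r → Q} {h : GL (Fin r) Q} (hc : c' ∈ affLat O c h) :
    affLat O c h = affLat O c' h := by
  ext z
  have : z - c = (z - c') + (c' - c) := by abel
  simp only [affLat, Set.mem_ofPred_eq, this, Matrix.add_vecMul, Pi.add_apply] at hc ⊢
  exact forall_congr' fun i => ⟨fun hz => by simpa using sub_mem hz (hc i),
    fun hz => add_mem hz (hc i)⟩

theorem mem_affLat_zero_one {z : Fin r → Q} : z ∈ affLat O 0 1 ↔ ∀ i, z i ∈ O := by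
  simp [affLat]

theorem row_mem_affLat (h : GL (Fin r) Q) (i : Fin r) : h.1.row i ∈ affLat O 0 h := by
  intro j
  have : Matrix.vecMul (h.1.row i - 0) ((h⁻¹ : GL (Fin r) Q) : Matrix (Fin r) (Fin r) Q) j =
      (h.1 * (h⁻¹).1) i j := by
    rw [sub_zero]; rfl
  rw [this, ← Units.val_mul, mul_inv_cancel, Units.val_one, Matrix.one_apply]
  split_ifs
  · exact one_mem O
  · exact zero_mem O

theorem conj_mem_of_mulGL_subset {c : Fin r → Q} {h k : GL (Fin r) Q}
    (hk : mulGL (affLat O c h) k ⊆ affLat O c h) (i j : Fin r) :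
    (h * k * h⁻¹).1 i j ∈ O := by
  have key (z) (hz : z ∈ affLat O c h) : ∀ j, Matrix.vecMul
      (Matrix.vecMul z k.1 - c) (h⁻¹).1 j ∈ O := hk ⟨z, hz, rfl⟩
  have h1 := key _ (mem_affLat_self c h) j
  have h2 := key (h.1.row i + c) (by
    intro j
    simpa using row_mem_affLat h i j) j
  have := sub_mem h2 h1
  rw [← Pi.sub_apply, ← Matrix.sub_vecMul, sub_sub_sub_cancel_right, ← Matrix.sub_vecMul,
    add_sub_cancel_right, Matrix.vecMul_vecMul] at this
  rw [mul_assoc]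
  exact this

theorem det_mem_of_mulGL_subset {c : Fin r → Q} {h k : GL (Fin r) Q}
    (hk : mulGL (affLat O c h) k ⊆ affLat O c h) : k.1.det ∈ O := by
  have h1 : k.1.det = (h * k * h⁻¹).1.det := by
    rw [Units.val_mul, Units.val_mul, Matrix.det_mul, Matrix.det_mul, mul_right_comm,
      ← Matrix.det_mul, ← Units.val_mul, mul_inv_cancel, Units.val_one, Matrix.det_one, one_mul]
  rw [h1, Matrix.det_apply]
  refine sum_mem fun σ _ => ?_
  rw [Units.smul_def]
  exact zsmul_mem (prod_mem fun i _ => conj_mem_of_mulGL_subset hk _ _) _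

theorem mulGL_affLat_subset {c : Fin r → Q} {h g : GL (Fin r) Q}
    (h1 : ∀ i j, (h * g * h⁻¹).1 i j ∈ O)
    (h2 : ∀ i, Matrix.vecMul (Matrix.vecMul c g.1 - c) (h⁻¹).1 i ∈ O) :
    mulGL (affLat O c h) g ⊆ affLat O c h := by
  rintro _ ⟨z, hz, rfl⟩ i
  have : Matrix.vecMul (Matrix.vecMul z g.1 - c) (h⁻¹).1 =
      Matrix.vecMul (Matrix.vecMul (z - c) (h⁻¹).1) (h * g * h⁻¹).1 +
      Matrix.vecMul (Matrix.vecMul c g.1 - c) (h⁻¹).1 := by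
    have e : h⁻¹ * (h * g * h⁻¹) = g * h⁻¹ := by group
    rw [Matrix.vecMul_vecMul, ← Units.val_mul, e, Units.val_mul, ← Matrix.vecMul_vecMul,
      ← Matrix.add_vecMul, Matrix.sub_vecMul g.1 z c, sub_add_sub_cancel]
  change Matrix.vecMul (Matrix.vecMul z g.1 - c) (h⁻¹).1 i ∈ O
  rw [this]
  exact add_mem (vecMul_mem hz h1 i) (h2 i)

theorem mulGL_standard_of_mem_range (g : GL (Fin r) Q)
    (hg : g ∈ (Matrix.GeneralLinearGroup.map (n := Fin r) (algebraMap O Q)).range) :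
    mulGL (affLat O 0 1) g = affLat O 0 1 := by
  obtain ⟨g, rfl⟩ := hg
  have key (g : GL (Fin r) O) : mulGL (affLat O 0 1)
      (Matrix.GeneralLinearGroup.map (n := Fin r) (algebraMap O Q) g) ⊆ affLat O 0 1 :=
    mulGL_affLat_subset (by simp) (by simp)
  refine mulGL_eq_of_subset (key g) ?_
  rw [← map_inv]
  exact key g⁻¹

/-- If `O^r h` contains an element `w` which is primitive in `O^r h'`, then modulo the common
stabilizer of `O^r h` and `O^r h'` every element of the stabilizer of `O^r h'` has
determinant one. -/
theorem exists_det_one {h h' k : GL (Fin r) Q} (hsub : affLat O 0 h ⊆ affLat O 0 h')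
    {w : Fin r → Q} (hw : w ∈ affLat O 0 h) {i : Fin r}
    (hi : (Matrix.vecMul w (h'⁻¹).1 i)⁻¹ ∈ O) (hi0 : Matrix.vecMul w (h'⁻¹).1 i ≠ 0)
    (hk : mulGL (affLat O 0 h') k = affLat O 0 h') :
    ∃ k₁ : GL (Fin r) Q, k₁.1.det = 1 ∧ mulGL (affLat O 0 h') k₁ = affLat O 0 h' ∧
      mulGL (affLat O 0 h) k₁ = mulGL (affLat O 0 h) k := by
  set a := Matrix.vecMul w (h'⁻¹).1 i with ha
  set φ : Fin r → Q := fun j => (h'⁻¹).1 j i * a⁻¹ with hφ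
  have hφz (z : Fin r → Q) : z ⬝ᵥ φ = Matrix.vecMul z (h'⁻¹).1 i * a⁻¹ := by
    simp [hφ, dotProduct, Matrix.vecMul, Finset.sum_mul, mul_assoc]
  have hwφ : w ⬝ᵥ φ = 1 := by rw [hφz, ← ha, mul_inv_cancel₀ hi0]
  let m (u : Q) : Matrix (Fin r) (Fin r) Q := 1 + (u - 1) • Matrix.vecMulVec φ w
  have hmm (u u' : Q) (huu : u * u' = 1) : m u * m u' = 1 := by
    have : Matrix.vecMulVec φ w * Matrix.vecMulVec φ w = Matrix.vecMulVec φ w := by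
      rw [Matrix.vecMulVec_mul_vecMulVec, hwφ, one_smul]
    simp only [m, add_mul, mul_add, one_mul, mul_one, smul_mul_assoc, mul_smul_comm, this]
    have h0 : u - 1 + (u' - 1 + (u' - 1) * (u - 1)) = 0 := by linear_combination huu
    have : (u - 1) • Matrix.vecMulVec φ w + (u' - 1) • (Matrix.vecMulVec φ w +
        (u - 1) • Matrix.vecMulVec φ w) =
        (u - 1 + (u' - 1 + (u' - 1) * (u - 1))) • Matrix.vecMulVec φ w := by module
    rw [add_assoc, this, h0, zero_smul, add_zero]
  have hdet (u : Q) : (m u).det = u := by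
    have : (u - 1) • Matrix.vecMulVec φ w = Matrix.replicateCol Unit ((u - 1) • φ) *
        Matrix.replicateRow Unit w := by
      ext i j; simp [Matrix.vecMulVec_apply, Matrix.mul_apply, mul_assoc]
    simp only [m]
    rw [this, Matrix.det_one_add_replicateCol_mul_replicateRow]
    simp [hwφ]
  have hmem (u : Q) (hu : u ∈ O) {h₁ : GL (Fin r) Q} (h1 : affLat O 0 h₁ ⊆ affLat O 0 h')
      (hw1 : w ∈ affLat O 0 h₁) {z} (hz : z ∈ affLat O 0 h₁) :
      Matrix.vecMul z (m u) ∈ affLat O 0 h₁ := by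
    have e : Matrix.vecMul z (m u) = z + ((u - 1) * (z ⬝ᵥ φ)) • w := by
      simp only [m, Matrix.vecMul_add, Matrix.vecMul_one, Matrix.vecMul_smul,
        Matrix.vecMul_vecMulVec, smul_smul]
    intro j
    have hz' := h1 hz i
    have hzj := hz j
    have hwj := hw1 j
    rw [sub_zero] at hz' hzj hwj ⊢
    rw [e, Matrix.add_vecMul, Matrix.smul_vecMul, hφz]
    exact add_mem hzj (mul_mem (mul_mem (sub_mem hu (one_mem O)) (mul_mem hz' hi)) hwj)
  have hk0 : k.1.det ≠ 0 := by
    have := k.isUnit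
    rw [Matrix.isUnit_iff_isUnit_det] at this
    exact this.ne_zero
  have hkd : k.1.det ∈ O := det_mem_of_mulGL_subset hk.subset
  have hkd' : k.1.det⁻¹ ∈ O := by
    have := det_mem_of_mulGL_subset (mulGL_inv_eq hk).subset
    rwa [Matrix.coe_units_inv, Matrix.det_nonsing_inv, Ring.inverse_eq_inv'] at this
  let g : GL (Fin r) Q := ⟨m k.1.det⁻¹, m k.1.det, hmm _ _ (inv_mul_cancel₀ hk0),
    hmm _ _ (mul_inv_cancel₀ hk0)⟩
  have hg {h₁ : GL (Fin r) Q} (h1 : affLat O 0 h₁ ⊆ affLat O 0 h')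
      (hw1 : w ∈ affLat O 0 h₁) : mulGL (affLat O 0 h₁) g = affLat O 0 h₁ := by
    refine mulGL_eq_of_subset ?_ ?_
    · rintro _ ⟨z, hz, rfl⟩
      exact hmem _ hkd' h1 hw1 hz
    · rintro _ ⟨z, hz, rfl⟩
      exact hmem _ hkd h1 hw1 hz
  refine ⟨g * k, ?_, ?_, ?_⟩
  · rw [Units.val_mul, Matrix.det_mul]
    change (m k.1.det⁻¹).det * _ = 1
    rw [hdet, inv_mul_cancel₀ hk0]
  · rw [mulGL_mul, hg subset_rfl (hsub hw), hk]
  · rw [mulGL_mul, hg hsub hw]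

end AffineLattice

section SpanIsAffineLattice

variable {Q : Type*} [Field Q] {r : ℕ} (O : ValuationSubring Q)

theorem mem_affLat_iff_exists {h : GL (Fin r) Q} {z : Fin r → Q} :
    z ∈ affLat O 0 h ↔ ∃ c : Fin r → O, z = ∑ i, c i • h.1.row i := by
  have e (c : Fin r → O) : ∑ i, c i • h.1.row i = Matrix.vecMul (fun i => (c i : Q)) h.1 := by
    ext j
    simp [Matrix.vecMul, dotProduct, Finset.sum_apply]
    rfl
  constructor
  · intro hz
    refine ⟨fun i => ⟨_, hz i⟩, ?_⟩
    rw [e]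
    simp only [sub_zero]
    change z = Matrix.vecMul (Matrix.vecMul z (h⁻¹).1) h.1
    rw [Matrix.vecMul_vecMul, ← Units.val_mul, inv_mul_cancel, Units.val_one, Matrix.vecMul_one]
  · rintro ⟨c, rfl⟩ i
    rw [e, sub_zero, Matrix.vecMul_vecMul, ← Units.val_mul, mul_inv_cancel, Units.val_one,
      Matrix.vecMul_one]
    exact (c i).2

/-- A finitely generated spanning `O`-submodule of `Q^r` is free of rank `r`. -/
theorem exists_span_eq_affLat [IsPrincipalIdealRing O] {S : Set (Fin r → Q)} (hS : S.Finite)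
    (hspan : Submodule.span Q S = ⊤) :
    ∃ h : GL (Fin r) Q, (Submodule.span O S : Set (Fin r → Q)) = affLat O 0 h := by
  set N := Submodule.span O S with hN
  have hNfin : Module.Finite O N := Module.Finite.span_of_finite O hS
  let b := Module.Free.chooseBasis O N
  have hspanb : Submodule.span O (Set.range fun i => (b i : Fin r → Q)) = N := by
    have := congrArg (Submodule.map N.subtype) b.span_eq
    rw [Submodule.map_span, Submodule.map_top, Submodule.range_subtype, ← Set.range_comp] at this
    exact this
  have hli : LinearIndependent O fun i => (b i : Fin r → Q) :=
    b.linearIndependent.map' N.subtype (Submodule.ker_subtype N)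
  have hliQ : LinearIndependent Q fun i => (b i : Fin r → Q) :=
    (LinearIndependent.iff_fractionRing O Q).1 hli
  have htop : ⊤ ≤ Submodule.span Q (Set.range fun i => (b i : Fin r → Q)) := by
    rw [← hspan, Submodule.span_le]
    intro s hs
    have : s ∈ Submodule.span O (Set.range fun i => (b i : Fin r → Q)) := by
      rw [hspanb]; exact Submodule.subset_span hs
    exact Submodule.span_subset_span O Q _ this
  let B := Module.Basis.mk hliQ htop
  have hcard : Fintype.card (Module.Free.ChooseBasisIndex O N) = Fintype.card (Fin r) := by
    rw [← Module.finrank_eq_card_basis B]; simp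
  let e : Fin r ≃ Module.Free.ChooseBasisIndex O N := (Fintype.equivOfCardEq hcard).symm
  let m : Matrix (Fin r) (Fin r) Q := Matrix.of fun i => (b (e i) : Fin r → Q)
  have hm : IsUnit m := by
    rw [← Matrix.linearIndependent_rows_iff_isUnit]
    exact hliQ.comp e e.injective
  refine ⟨hm.unit, ?_⟩
  ext z
  rw [mem_affLat_iff_exists, SetLike.mem_coe, ← hspanb]
  have : (Set.range fun i => (b i : Fin r → Q)) = Set.range fun i => m.row i := by
    rw [← e.surjective.range_comp]; rfl
  rw [this, Submodule.mem_span_range_iff_exists_fun]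
  exact exists_congr fun c => eq_comm

end SpanIsAffineLattice

section Completion

variable {R : Type*} [CommRing R] [IsDedekindDomain R]
  {F : Type*} [Field F] [Algebra R F] [IsFractionRing R F] (p : HeightOneSpectrum R)

theorem adic_mem_nhds {s : Set (p.adicCompletion F)} {x : p.adicCompletion F} :
    s ∈ nhds x ↔ ∃ γ : WithZero (Multiplicative ℤ), γ ≠ 0 ∧ {y | Valued.v (y - x) < γ} ⊆ s := by
  rw [Valued.mem_nhds]
  constructor
  · rintro ⟨γ, h⟩
    refine ⟨MonoidWithZeroHom.ValueGroup₀.embedding γ.1, by simp, ?_⟩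
    intro y hy
    exact h ((Valuation.restrict_lt_iff_lt_embedding _).2 hy)
  · rintro ⟨γ, h0, h⟩
    obtain ⟨t, rfl⟩ := p.valuedAdicCompletion_surjective F γ
    refine ⟨Units.mk0 (Valued.v.restrict t) (by simpa using h0), ?_⟩
    intro y hy
    exact h ((Valuation.restrict_lt_iff _).1 hy)

theorem isOpen_adicCompletionIntegers :
    IsOpen (p.adicCompletionIntegers F : Set (p.adicCompletion F)) :=
  Valued.isOpen_valuationSubring _

theorem isClosed_adicCompletionIntegers :
    IsClosed (p.adicCompletionIntegers F : Set (p.adicCompletion F)) :=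
  (Valued.isClopen_valuationSubring _).1

theorem exists_field_valued_sub_lt (y : p.adicCompletion F) {γ : WithZero (Multiplicative ℤ)}
    (hγ : γ ≠ 0) : ∃ x : F, Valued.v (algebraMap F (p.adicCompletion F) x - y) < γ :=
  DenseRange.mem_nhds (HeightOneSpectrum.denseRange_algebraMap F p)
    ((adic_mem_nhds p).2 ⟨γ, hγ, subset_rfl⟩)

theorem exists_algebraMap_valued_sub_lt {y : p.adicCompletion F}
    (hy : y ∈ p.adicCompletionIntegers F) {γ : WithZero (Multiplicative ℤ)} (hγ : γ ≠ 0) :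
    ∃ a : R, Valued.v (algebraMap F (p.adicCompletion F) (algebraMap R F a) - y) < γ := by
  obtain ⟨x, hx⟩ := exists_field_valued_sub_lt p y
    (γ := min γ 1) (by rcases min_choice γ 1 with h | h <;> simp [h, hγ])
  have hx1 : p.valuation F x ≤ 1 := by
    rw [← p.valuedAdicCompletion_eq_valuation', ← sub_add_cancel (x : p.adicCompletion F) y]
    exact (Valuation.map_add _ _ _).trans
      (max_le (hx.le.trans (min_le_right _ _)) ((p.mem_adicCompletionIntegers R F).1 hy))
  obtain ⟨a, ha⟩ := p.exists_valuation_sub_lt_of_integer hx1 (Units.mk0 γ hγ)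
  refine ⟨a, ?_⟩
  rw [← p.valuedAdicCompletion_eq_valuation'] at ha
  rw [← sub_add_sub_cancel _ (algebraMap F (p.adicCompletion F) x)]
  refine (Valuation.map_add _ _ _).trans_lt (max_lt ?_ (hx.trans_le (min_le_left _ _)))
  rw [← map_sub]
  exact ha

theorem mem_closure_range_algebraMap {y : p.adicCompletion F}
    (hy : y ∈ p.adicCompletionIntegers F) :
    y ∈ closure (Set.range fun a : R => algebraMap F (p.adicCompletion F) (algebraMap R F a)) := by
  rw [mem_closure_iff_nhds]
  intro s hs
  obtain ⟨γ, h0, h⟩ := (adic_mem_nhds p).1 hs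
  obtain ⟨a, ha⟩ := exists_algebraMap_valued_sub_lt p hy h0
  exact ⟨_, h ha, a, rfl⟩

theorem algebraMap_mem_adicCompletionIntegers (a : R) :
    algebraMap F (p.adicCompletion F) (algebraMap R F a) ∈ p.adicCompletionIntegers F :=
  p.coe_algebraMap_mem R F a

variable {p}

theorem continuous_vecMul {r : ℕ} (m : Matrix (Fin r) (Fin r) (p.adicCompletion F)) :
    Continuous fun z : Fin r → p.adicCompletion F => Matrix.vecMul z m :=
  Continuous.matrix_vecMul continuous_id continuous_const

theorem affLat_eq_preimage {r : ℕ} (c : Fin r → p.adicCompletion F)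
    (h : GL (Fin r) (p.adicCompletion F)) :
    affLat (p.adicCompletionIntegers F) c h = (fun z => Matrix.vecMul (z - c) (h⁻¹).1) ⁻¹'
      Set.pi Set.univ fun _ => (p.adicCompletionIntegers F : Set (p.adicCompletion F)) := by
  ext z
  simp [affLat]

theorem isClosed_affLat {r : ℕ} (c : Fin r → p.adicCompletion F)
    (h : GL (Fin r) (p.adicCompletion F)) :
    IsClosed (affLat (p.adicCompletionIntegers F) c h) := by
  rw [affLat_eq_preimage]
  exact (isClosed_set_pi fun _ _ => isClosed_adicCompletionIntegers p).preimage
    ((continuous_vecMul _).comp (continuous_id.sub continuous_const))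

theorem closure_mulGL {r : ℕ} (k : GL (Fin r) (p.adicCompletion F))
    (S : Set (Fin r → p.adicCompletion F)) : closure (mulGL S k) = mulGL (closure S) k := by
  let e : (Fin r → p.adicCompletion F) ≃ₜ (Fin r → p.adicCompletion F) :=
    { toFun := fun z => Matrix.vecMul z k.1
      invFun := fun z => Matrix.vecMul z (k⁻¹).1
      left_inv := fun z => by
        beta_reduce
        rw [Matrix.vecMul_vecMul, ← Units.val_mul, mul_inv_cancel, Units.val_one,
          Matrix.vecMul_one]
      right_inv := fun z => by
        beta_reduce
        rw [Matrix.vecMul_vecMul, ← Units.val_mul, inv_mul_cancel, Units.val_one,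
          Matrix.vecMul_one]
      continuous_toFun := continuous_vecMul _
      continuous_invFun := continuous_vecMul _ }
  exact (e.image_closure S).symm

variable (p)

theorem embVec_vecMul {r : ℕ} (x : Fin r → F) (γ : GL (Fin r) F) :
    embVec R F p (Matrix.vecMul x γ.1) = Matrix.vecMul (embVec R F p x) (embGL R F p γ).1 := by
  funext i
  exact RingHom.map_vecMul (algebraMap F (p.adicCompletion F)) γ.1 x i

theorem locCl_mulGL {r : ℕ} (S : Set (Fin r → F)) (γ : GL (Fin r) F) :
    locCl R F p (mulGL S γ) = mulGL (locCl R F p S) (embGL R F p γ) := by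
  rw [locCl, locCl, ← closure_mulGL, mulGL, mulGL, Set.image_image, Set.image_image]
  simp only [embVec_vecMul]

theorem embVec_add {r : ℕ} (x y : Fin r → F) :
    embVec R F p (x + y) = embVec R F p x + embVec R F p y := by
  ext i
  simp [embVec]

theorem embVec_sub {r : ℕ} (x y : Fin r → F) :
    embVec R F p (x - y) = embVec R F p x - embVec R F p y := by
  ext i
  simp [embVec]

theorem cosetOf_eq_image {G : Type*} [AddCommGroup G] (v : G) (S : Set G) :
    cosetOf v S = (fun x => v + x) '' S := by
  ext x
  constructor
  · intro h
    exact ⟨x - v, h, by simp⟩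
  · rintro ⟨y, hy, rfl⟩
    simpa [cosetOf] using hy

theorem locCl_cosetOf {r : ℕ} (v : Fin r → F) (S : Set (Fin r → F)) :
    locCl R F p (cosetOf v S) = cosetOf (embVec R F p v) (locCl R F p S) := by
  rw [cosetOf_eq_image, cosetOf_eq_image, locCl, locCl,
    show (fun x => embVec R F p v + x) '' closure ((fun x => embVec R F p x) '' S) =
      closure ((fun x => embVec R F p v + x) '' ((fun x => embVec R F p x) '' S)) from
      (Homeomorph.addLeft (embVec R F p v)).image_closure _, Set.image_image, Set.image_image]
  simp only [embVec_add]

theorem subset_locCl {r : ℕ} {S : Set (Fin r → F)} {x : Fin r → F} (hx : x ∈ S) :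
    embVec R F p x ∈ locCl R F p S :=
  subset_closure ⟨x, hx, rfl⟩

/-- The closure of an `R`-lattice is the `O_p`-lattice it generates. -/
theorem locCl_span {r : ℕ} {S : Set (Fin r → F)} {h : GL (Fin r) (p.adicCompletion F)}
    (hS : (Submodule.span (p.adicCompletionIntegers F) (embVec R F p '' S) :
      Set (Fin r → p.adicCompletion F)) = affLat (p.adicCompletionIntegers F) 0 h) :
    locCl R F p (Submodule.span R S : Set (Fin r → F)) =
      affLat (p.adicCompletionIntegers F) 0 h := by
  have hsmul (a : R) (x : Fin r → F) : embVec R F p (a • x) =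
      algebraMap F (p.adicCompletion F) (algebraMap R F a) • embVec R F p x := by
    ext i
    simp [embVec, Algebra.smul_def]
  apply subset_antisymm
  · refine closure_minimal ?_ (isClosed_affLat 0 h)
    rintro _ ⟨x, hx, rfl⟩
    rw [← hS]
    refine Submodule.span_induction ?_ ?_ ?_ ?_ hx
    · intro x hx
      exact Submodule.subset_span ⟨x, hx, rfl⟩
    · have : embVec R F p (0 : Fin r → F) = 0 := by ext i; simp [embVec]
      simp only [this]
      exact Submodule.zero_mem _
    · intro x y _ _ hx hy
      simp only [embVec_add]
      exact Submodule.add_mem _ hx hy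
    · intro a x _ hx
      simp only [hsmul]
      exact Submodule.smul_mem _
        (⟨_, algebraMap_mem_adicCompletionIntegers p a⟩ : p.adicCompletionIntegers F) hx
  · rw [← hS]
    intro z hz
    refine Submodule.span_induction ?_ ?_ ?_ ?_ hz
    · rintro _ ⟨x, hx, rfl⟩
      exact subset_locCl p (Submodule.subset_span hx)
    · have := subset_locCl p (Submodule.zero_mem (Submodule.span R S))
      have e : embVec R F p (0 : Fin r → F) = 0 := by ext i; simp [embVec]
      rwa [e] at this
    · intro x y _ _ hx hy
      refine map_mem_closure₂ continuous_add hx hy ?_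
      rintro _ ⟨x, hx, rfl⟩ _ ⟨y, hy, rfl⟩
      exact ⟨x + y, Submodule.add_mem _ hx hy, embVec_add p x y⟩
    · intro a x _ hx
      refine map_mem_closure₂ (f := fun (a : p.adicCompletion F)
        (x : Fin r → p.adicCompletion F) => a • x) continuous_smul
        (mem_closure_range_algebraMap p a.2) hx ?_
      rintro _ ⟨a, rfl⟩ _ ⟨x, hx, rfl⟩
      exact ⟨a • x, Submodule.smul_mem _ _ hx, hsmul a x⟩

theorem span_embVec_eq_top {r : ℕ} {S : Set (Fin r → F)} (hS : Submodule.span F S = ⊤) :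
    Submodule.span (p.adicCompletion F) (embVec R F p '' S) = ⊤ := by
  have h1 (x : Fin r → F) :
      embVec R F p x ∈ Submodule.span (p.adicCompletion F) (embVec R F p '' S) := by
    have hx : x ∈ Submodule.span F S := hS ▸ Submodule.mem_top
    induction hx using Submodule.span_induction with
    | mem x hx => exact Submodule.subset_span ⟨x, hx, rfl⟩
    | zero =>
      have e : embVec R F p (0 : Fin r → F) = 0 := by ext i; simp [embVec]
      rw [e]; exact Submodule.zero_mem _
    | add x y _ _ hx hy => rw [embVec_add]; exact Submodule.add_mem _ hx hy
    | smul a x _ hx =>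
      have : embVec R F p (a • x) = algebraMap F (p.adicCompletion F) a • embVec R F p x := by
        ext i; simp [embVec]
      rw [this]; exact Submodule.smul_mem _ _ hx
  rw [eq_top_iff]
  intro z _
  have hz : z = ∑ i, z i • embVec R F p (Pi.single i 1) := by
    ext j
    simp [embVec, Finset.sum_apply, Pi.single_apply]
  rw [hz]
  exact Submodule.sum_mem _ fun i _ => Submodule.smul_mem _ _ (h1 _)

/-- The completion of a lattice is `O_p^r h` for some `h`. -/
theorem exists_locCl_eq_affLat {r : ℕ} {M : Submodule R (Fin r → F)} (hfg : M.FG)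
    (hspan : Submodule.span F (M : Set (Fin r → F)) = ⊤) :
    ∃ h : GL (Fin r) (p.adicCompletion F),
      locCl R F p (M : Set (Fin r → F)) = affLat (p.adicCompletionIntegers F) 0 h := by
  obtain ⟨S, rfl⟩ := hfg
  rw [Submodule.span_span_of_tower] at hspan
  obtain ⟨h, hh⟩ := exists_span_eq_affLat (p.adicCompletionIntegers F)
    (S.finite_toSet.image (embVec R F p)) (span_embVec_eq_top p hspan)
  exact ⟨h, locCl_span p hh⟩

end Completion

section LocalOrbits

variable {R : Type*} [CommRing R] [IsDedekindDomain R]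
  {F : Type*} [Field F] [Algebra R F] [IsFractionRing R F] {p : HeightOneSpectrum R} {r : ℕ}

theorem eventually_mulGL_affLat_eq (c : Fin r → p.adicCompletion F)
    (h k : GL (Fin r) (p.adicCompletion F)) :
    ∀ᶠ g in nhds k, mulGL (affLat (p.adicCompletionIntegers F) c h) g =
      mulGL (affLat (p.adicCompletionIntegers F) c h) k := by
  set O := p.adicCompletionIntegers F
  have h1 : ∀ᶠ g in nhds (1 : GL (Fin r) (p.adicCompletion F)),
      mulGL (affLat O c h) g ⊆ affLat O c h := by
    have hc1 (i j) : Continuous fun g : GL (Fin r) (p.adicCompletion F) =>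
        (h * g * h⁻¹).1 i j :=
      (Units.continuous_val.comp ((continuous_const.mul continuous_id).mul
        continuous_const)).matrix_elem i j
    have hc2 (i) : Continuous fun g : GL (Fin r) (p.adicCompletion F) =>
        Matrix.vecMul (Matrix.vecMul c g.1 - c) (h⁻¹).1 i :=
      (continuous_apply i).comp ((continuous_vecMul _).comp
        ((Continuous.matrix_vecMul continuous_const Units.continuous_val).sub continuous_const))
    have e1 : ∀ᶠ g in nhds (1 : GL (Fin r) (p.adicCompletion F)),
        ∀ i j, (h * g * h⁻¹).1 i j ∈ O := by
      refine Filter.eventually_all.2 fun i => Filter.eventually_all.2 fun j => ?_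
      refine (hc1 i j).continuousAt.eventually_mem ((isOpen_adicCompletionIntegers p).mem_nhds ?_)
      rw [mul_one, mul_inv_cancel, Units.val_one, Matrix.one_apply]
      split_ifs
      · exact one_mem O
      · exact zero_mem O
    have e2 : ∀ᶠ g in nhds (1 : GL (Fin r) (p.adicCompletion F)),
        ∀ i, Matrix.vecMul (Matrix.vecMul c g.1 - c) (h⁻¹).1 i ∈ O := by
      refine Filter.eventually_all.2 fun i => ?_
      refine (hc2 i).continuousAt.eventually_mem ((isOpen_adicCompletionIntegers p).mem_nhds ?_)
      simp
    filter_upwards [e1, e2] with g hg1 hg2 using mulGL_affLat_subset hg1 hg2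
  have h2 : ∀ᶠ g in nhds (1 : GL (Fin r) (p.adicCompletion F)),
      mulGL (affLat O c h) g⁻¹ ⊆ affLat O c h := by
    have : Filter.Tendsto (fun g : GL (Fin r) (p.adicCompletion F) => g⁻¹) (nhds 1) (nhds 1) := by
      simpa using (continuous_inv.tendsto (1 : GL (Fin r) (p.adicCompletion F)))
    exact this.eventually h1
  have h3 : Filter.Tendsto (fun g : GL (Fin r) (p.adicCompletion F) => g * k⁻¹)
      (nhds k) (nhds 1) := by
    simpa using (continuous_mul_const k⁻¹).tendsto k
  filter_upwards [h3.eventually h1, h3.eventually h2] with g hg1 hg2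
  have := mulGL_eq_of_subset hg1 hg2
  calc mulGL (affLat O c h) g = mulGL (affLat O c h) (g * k⁻¹ * k) := by
        rw [inv_mul_cancel_right]
    _ = _ := by rw [mulGL_mul, this]

theorem exists_common_denominator {ι : Type*} [Finite ι] (a : ι → p.adicCompletion F) :
    ∃ t : R, t ≠ 0 ∧ ∀ i, algebraMap F (p.adicCompletion F) (algebraMap R F t) * a i ∈
      p.adicCompletionIntegers F := by
  have := Fintype.ofFinite ι
  choose b hb hab using fun i =>
    HeightOneSpectrum.adicCompletion.mul_nonZeroDivisor_mem_adicCompletionIntegers p (a i)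
  have hab (i) : a i * algebraMap F (p.adicCompletion F) (algebraMap R F (b i)) ∈
    p.adicCompletionIntegers F := hab i
  refine ⟨∏ i, b i, nonZeroDivisors.ne_zero (prod_mem fun i _ => hb i), fun i => ?_⟩
  obtain ⟨d, hd⟩ := Finset.dvd_prod_of_mem b (Finset.mem_univ i)
  rw [hd, map_mul, map_mul]
  have := mul_mem (algebraMap_mem_adicCompletionIntegers (F := F) p d) (hab i)
  convert! this using 1
  ring

theorem add_vecMul_mem_mulGL {c c' : Fin r → p.adicCompletion F}
    {h h' k : GL (Fin r) (p.adicCompletion F)} {t : p.adicCompletion F}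
    (ht : ∀ i j, t * (h' * h⁻¹).1 i j ∈ p.adicCompletionIntegers F)
    (hk : mulGL (affLat (p.adicCompletionIntegers F) c' h') k =
      affLat (p.adicCompletionIntegers F) c' h')
    {z : Fin r → p.adicCompletion F}
    (hz : z ∈ mulGL (affLat (p.adicCompletionIntegers F) c h) k)
    {o : Fin r → p.adicCompletion F} (ho : ∀ i, o i ∈ p.adicCompletionIntegers F) :
    z + Matrix.vecMul (t • o) h'.1 ∈ mulGL (affLat (p.adicCompletionIntegers F) c h) k := by
  rw [mem_mulGL_iff] at hz ⊢
  intro i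
  have e : h'.1 * (k⁻¹).1 * (h⁻¹).1 = (h' * k⁻¹ * h'⁻¹).1 * (h' * h⁻¹).1 := by
    simp only [← Units.val_mul]
    congr 1
    group
  have : Matrix.vecMul (Matrix.vecMul (z + Matrix.vecMul (t • o) h'.1) (k⁻¹).1 - c) (h⁻¹).1 =
      Matrix.vecMul (Matrix.vecMul z (k⁻¹).1 - c) (h⁻¹).1 +
      Matrix.vecMul (Matrix.vecMul o (h' * k⁻¹ * h'⁻¹).1) (t • (h' * h⁻¹).1) := by
    rw [Matrix.vecMul_smul, Matrix.vecMul_vecMul, ← e, ← Matrix.smul_vecMul,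
      ← Matrix.vecMul_vecMul, ← Matrix.vecMul_vecMul, ← Matrix.add_vecMul,
      Matrix.add_vecMul (k⁻¹).1]
    congr 1
    abel
  rw [this]
  exact add_mem (hz i) (vecMul_mem (vecMul_mem ho
    (conj_mem_of_mulGL_subset (mulGL_inv_eq hk).subset)) ht i)

/-- The orbit of a coset `c + O^r h` under the stabilizer of a larger coset is finite. -/
theorem finite_orbit_affLat [Ring.HasFiniteQuotients R] {c c' : Fin r → p.adicCompletion F}
    {h h' : GL (Fin r) (p.adicCompletion F)}
    (hsub : affLat (p.adicCompletionIntegers F) c h ⊆ affLat (p.adicCompletionIntegers F) c' h') :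
    {Z | ∃ k : GL (Fin r) (p.adicCompletion F),
      mulGL (affLat (p.adicCompletionIntegers F) c' h') k =
        affLat (p.adicCompletionIntegers F) c' h' ∧
      Z = mulGL (affLat (p.adicCompletionIntegers F) c h) k}.Finite := by
  set O := p.adicCompletionIntegers F
  obtain ⟨t, ht0, ht⟩ := exists_common_denominator (p := p) (F := F)
    fun ij : Fin r × Fin r => (h' * h⁻¹).1 ij.1 ij.2
  set τ := algebraMap F (p.adicCompletion F) (algebraMap R F t) with hτ
  have hτ0 : τ ≠ 0 := by simpa [hτ] using ht0
  have : Finite (R ⧸ Ideal.span {t}) :=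
    Ring.HasFiniteQuotients.finiteQuotient (by simpa using ht0)
  let pt (a : Fin r → R ⧸ Ideal.span {t}) : Fin r → p.adicCompletion F :=
    c' + Matrix.vecMul (fun i => algebraMap F (p.adicCompletion F)
      (algebraMap R F (Quotient.out (a i)))) h'.1
  let Φ (Z : Set (Fin r → p.adicCompletion F)) : Set (Fin r → R ⧸ Ideal.span {t}) :=
    {a | pt a ∈ Z}
  refine Set.Finite.of_finite_image (f := Φ) (Set.toFinite _) ?_
  have key {k₁ k₂ : GL (Fin r) (p.adicCompletion F)}
      (hk₁ : mulGL (affLat O c' h') k₁ = affLat O c' h')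
      (hk₂ : mulGL (affLat O c' h') k₂ = affLat O c' h')
      (hΦ : Φ (mulGL (affLat O c h) k₁) = Φ (mulGL (affLat O c h) k₂)) :
      mulGL (affLat O c h) k₁ ⊆ mulGL (affLat O c h) k₂ := by
    intro z hz
    have hy : ∀ i, Matrix.vecMul (z - c') (h'⁻¹).1 i ∈ O := by
      have : z ∈ affLat O c' h' := hk₁ ▸ mulGL_mono hsub k₁ hz
      exact this
    set y := Matrix.vecMul (z - c') (h'⁻¹).1 with hy'
    choose a ha using fun i => exists_algebraMap_valued_sub_lt p (hy i)
      (γ := Valued.v τ) (by simpa using hτ0)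
    let b : Fin r → R ⧸ Ideal.span {t} := fun i => Ideal.Quotient.mk _ (a i)
    have hb (i) : ∃ d, Quotient.out (b i) - a i = t * d := by
      have : Ideal.Quotient.mk (Ideal.span {t}) (Quotient.out (b i)) = Ideal.Quotient.mk _ (a i) :=
        Quotient.out_eq _
      exact Ideal.mem_span_singleton.1 (Ideal.Quotient.eq.1 this)
    choose d hd using hb
    let o : Fin r → p.adicCompletion F := fun i =>
      τ⁻¹ * (algebraMap F (p.adicCompletion F) (algebraMap R F (Quotient.out (b i))) - y i)
    have ho (i) : o i ∈ O := by
      have e : o i = algebraMap F (p.adicCompletion F) (algebraMap R F (d i)) +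
          τ⁻¹ * (algebraMap F (p.adicCompletion F) (algebraMap R F (a i)) - y i) := by
        simp only [o]
        rw [eq_add_of_sub_eq (hd i), map_add, map_add, map_mul, map_mul, ← hτ]
        field_simp
        ring
      rw [e]
      refine add_mem (algebraMap_mem_adicCompletionIntegers p _) ?_
      rw [HeightOneSpectrum.mem_adicCompletionIntegers, map_mul, map_inv₀]
      exact inv_mul_le_one_of_le₀ (ha i).le zero_le
    have hpt : pt b = z + Matrix.vecMul (τ • o) h'.1 := by
      have e : τ • o = (fun i => algebraMap F (p.adicCompletion F)
          (algebraMap R F (Quotient.out (b i)))) - y := by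
        funext i
        simp only [o, Pi.smul_apply, smul_eq_mul, Pi.sub_apply]
        rw [mul_inv_cancel_left₀ hτ0]
      rw [e, Matrix.sub_vecMul, hy', Matrix.vecMul_vecMul, ← Units.val_mul, inv_mul_cancel,
        Units.val_one, Matrix.vecMul_one]
      simp only [pt]
      abel
    have h1 : pt b ∈ mulGL (affLat O c h) k₁ := by
      rw [hpt]; exact add_vecMul_mem_mulGL (fun i j => ht (i, j)) hk₁ hz ho
    have h2 : pt b ∈ mulGL (affLat O c h) k₂ := by
      have : b ∈ Φ (mulGL (affLat O c h) k₁) := h1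
      rw [hΦ] at this
      exact this
    have h3 := add_vecMul_mem_mulGL (fun i j => ht (i, j)) hk₂ h2 (o := -o)
      (fun i => neg_mem (ho i))
    rwa [hpt, smul_neg, Matrix.neg_vecMul, add_neg_cancel_right] at h3
  rintro _ ⟨k₁, hk₁, rfl⟩ _ ⟨k₂, hk₂, rfl⟩ hΦ
  exact subset_antisymm (key hk₁ hk₂ hΦ) (key hk₂ hk₁ hΦ.symm)

theorem exists_det_one_of_not_subset {h h' k : GL (Fin r) (p.adicCompletion F)}
    (hsub : affLat (p.adicCompletionIntegers F) 0 h ⊆ affLat (p.adicCompletionIntegers F) 0 h')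
    (hn : ¬ affLat (p.adicCompletionIntegers F) 0 h ⊆
      mIdealSMul R F p (affLat (p.adicCompletionIntegers F) 0 h'))
    (hk : mulGL (affLat (p.adicCompletionIntegers F) 0 h') k =
      affLat (p.adicCompletionIntegers F) 0 h') :
    ∃ k₁ : GL (Fin r) (p.adicCompletion F), k₁.1.det = 1 ∧
      mulGL (affLat (p.adicCompletionIntegers F) 0 h') k₁ =
        affLat (p.adicCompletionIntegers F) 0 h' ∧
      mulGL (affLat (p.adicCompletionIntegers F) 0 h) k₁ =
        mulGL (affLat (p.adicCompletionIntegers F) 0 h) k := by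
  obtain ⟨w, hw, hw'⟩ := Set.not_subset.1 hn
  obtain ⟨i, hi⟩ : ∃ i, ¬ Valued.v (Matrix.vecMul w (h'⁻¹).1 i) < 1 := by
    by_contra! hlt
    refine hw' ?_
    have e : w = ∑ i, Matrix.vecMul w (h'⁻¹).1 i • h'.1.row i := by
      refine Eq.trans ?_ (Matrix.vecMul_eq_sum _ h'.1)
      rw [Matrix.vecMul_vecMul, ← Units.val_mul, inv_mul_cancel,
        Units.val_one, Matrix.vecMul_one]
    rw [e, mIdealSMul, SetLike.mem_coe]
    refine sum_mem fun i _ => ?_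
    exact AddSubgroup.subset_closure ⟨_, hlt i, _, row_mem_affLat h' i, rfl⟩
  have hi1 : Valued.v (Matrix.vecMul w (h'⁻¹).1 i) = 1 := by
    refine le_antisymm ?_ (not_lt.1 hi)
    have := hsub hw i
    rwa [sub_zero, HeightOneSpectrum.mem_adicCompletionIntegers] at this
  refine exists_det_one hsub hw (i := i) ?_ ?_ hk
  · rw [HeightOneSpectrum.mem_adicCompletionIntegers, map_inv₀, hi1, inv_one]
  · intro h0
    rw [h0, map_zero] at hi1
    exact zero_ne_one hi1

end LocalOrbits

section Transvections

open Matrix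

theorem diag2n_eq_transvection_mul {ι K : Type*} [Fintype ι] [DecidableEq ι] [Field K] {i j : ι}
    (hij : i ≠ j) {a : K} (ha : a ≠ 0) :
    SpecialLinearGroup.diag2n hij a ha =
      SpecialLinearGroup.transvection hij a *
      SpecialLinearGroup.transvection hij.symm (-a⁻¹) *
      SpecialLinearGroup.transvection hij a *
      SpecialLinearGroup.transvection hij (-1) *
      SpecialLinearGroup.transvection hij.symm 1 *
      SpecialLinearGroup.transvection hij (-1) := by
  apply Subtype.ext
  have hmul (A B : SpecialLinearGroup ι K) : (A * B).1 = A.1 * B.1 := rfl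
  simp only [hmul, SpecialLinearGroup.transvection_coe, SpecialLinearGroup.diag2n_coe,
    mul_add, add_mul, mul_one, one_mul,
    Matrix.single_mul_single_same, Matrix.single_mul_single_of_ne _ _ _ _ hij,
    Matrix.single_mul_single_of_ne _ _ _ _ hij.symm, add_zero]
  ext k l
  simp only [Matrix.diagonal_apply, Matrix.add_apply, Matrix.single_apply, Matrix.one_apply]
  by_cases hki : k = i <;> by_cases hkj : k = j <;> by_cases hli : l = i <;>
    by_cases hlj : l = j <;> grind

theorem SpecialLinearGroup_transvection_induction {ι K : Type*} [Fintype ι] [DecidableEq ι]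
    [Field K] [Nontrivial ι] (P : SpecialLinearGroup ι K → Prop) (M : SpecialLinearGroup ι K)
    (htransvec : ∀ (i j : ι) (hij : i ≠ j) (a : K), P (SpecialLinearGroup.transvection hij a))
    (hmul : ∀ A B, P A → P B → P (A * B)) : P M := by
  refine SpecialLinearGroup.diagonal_transvection_induction' P M (fun i j hij c hc => ?_)
    htransvec hmul
  rw [diag2n_eq_transvection_mul]
  refine hmul _ _ (hmul _ _ (hmul _ _ (hmul _ _ (hmul _ _ ?_ ?_) ?_) ?_) ?_) ?_
  all_goals exact htransvec _ _ _ _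

end Transvections

section StrongApproximation

variable {R : Type*} [CommRing R] [IsDedekindDomain R]
  {F : Type*} [Field F] [Algebra R F] [IsFractionRing R F]

theorem valued_algebraMap_eq_intValuation (p : HeightOneSpectrum R) (a : R) :
    Valued.v (algebraMap F (p.adicCompletion F) (algebraMap R F a)) = p.intValuation a := by
  rw [← HeightOneSpectrum.valuation_of_algebraMap (K := F)]
  exact HeightOneSpectrum.valuedAdicCompletion_eq_valuation' p _

theorem exists_exp_neg_lt {γ : WithZero (Multiplicative ℤ)} (hγ : γ ≠ 0) :
    ∃ n : ℕ, WithZero.exp (-(n : ℤ)) < γ := by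
  refine ⟨(1 - WithZero.log γ).toNat, ?_⟩
  rw [← WithZero.exp_log hγ, WithZero.exp_lt_exp]
  simp
  omega

/-- Finitely many integral approximation conditions, with arbitrary integrality elsewhere. -/
theorem exists_integer_valued_sub_lt (S : Finset (HeightOneSpectrum R))
    (a : HeightOneSpectrum R → R) (γ : HeightOneSpectrum R → WithZero (Multiplicative ℤ))
    (hγ : ∀ p ∈ S, γ p ≠ 0) :
    ∃ n : R, ∀ p ∈ S, p.intValuation (n - a p) < γ p := by
  classical
  choose! e he using fun p hp => exists_exp_neg_lt (hγ p hp)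
  obtain ⟨n, hn⟩ := IsDedekindDomain.exists_forall_sub_mem_ideal (s := S)
    (fun p => p.asIdeal) e (fun p _ => p.prime)
    (fun p _ q _ hpq h => hpq (HeightOneSpectrum.ext h)) (fun p => a p)
  exact ⟨n, fun p hp => ((p.intValuation_le_pow_iff_mem _ _).2 (hn p hp)).trans_lt (he p hp)⟩

theorem finite_setOf_mem_asIdeal {d : R} (hd : d ≠ 0) :
    {p : HeightOneSpectrum R | d ∈ p.asIdeal}.Finite := by
  have h := HeightOneSpectrum.Support.finite R ((algebraMap R (FractionRing R) d)⁻¹)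
  refine h.subset fun p (hp : d ∈ p.asIdeal) => ?_
  change 1 < p.valuation (FractionRing R) _
  rw [map_inv₀, one_lt_inv₀, HeightOneSpectrum.valuation_of_algebraMap]
  · exact (p.intValuation_lt_one_iff_mem d).2 hp
  · rw [HeightOneSpectrum.valuation_of_algebraMap]
    exact zero_lt_iff.2 (p.intValuation_ne_zero d hd)

/-- Strong approximation for the additive group. -/
theorem exists_strong_approx (T : Finset (HeightOneSpectrum R))
    (a : ∀ p : HeightOneSpectrum R, p.adicCompletion F)
    (γ : HeightOneSpectrum R → WithZero (Multiplicative ℤ)) (hγ : ∀ p ∈ T, γ p ≠ 0) :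
    ∃ b : F, (∀ p ∈ T, Valued.v (algebraMap F (p.adicCompletion F) b - a p) < γ p) ∧
      ∀ p ∉ T, algebraMap F (p.adicCompletion F) b ∈ p.adicCompletionIntegers F := by
  classical
  choose! x hx using fun p hp => exists_field_valued_sub_lt p (a p) (hγ p hp)
  obtain ⟨d, hd⟩ := IsLocalization.exist_integer_multiples_of_finset (nonZeroDivisors R)
    (T.image x)
  have hd0 : (d : R) ≠ 0 := nonZeroDivisors.ne_zero d.2
  choose! n hn using fun p (hp : p ∈ T) => hd (x p) (Finset.mem_image_of_mem x hp)
  let S := T ∪ (finite_setOf_mem_asIdeal hd0).toFinset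
  obtain ⟨m, hm⟩ := exists_integer_valued_sub_lt S (fun p => if p ∈ T then n p else 0)
    (fun p => if p ∈ T then γ p * p.intValuation d else p.intValuation d) (fun p _ => by
      split_ifs with h
      · exact mul_ne_zero (hγ p h) (p.intValuation_ne_zero _ hd0)
      · exact p.intValuation_ne_zero _ hd0)
  have hdF : algebraMap R F d ≠ 0 := by simp
  have hv (p : HeightOneSpectrum R) : 0 < p.intValuation (d : R) :=
    zero_lt_iff.2 (p.intValuation_ne_zero _ hd0)
  refine ⟨algebraMap R F m / algebraMap R F d, fun p hp => ?_, fun p hp => ?_⟩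
  · have h1 := hm p (Finset.mem_union_left _ hp)
    simp only [if_pos hp] at h1
    have e : algebraMap F (p.adicCompletion F) (algebraMap R F m / algebraMap R F d) - a p =
        algebraMap F (p.adicCompletion F) (algebraMap R F m / algebraMap R F d - x p) +
        (algebraMap F (p.adicCompletion F) (x p) - a p) := by
      rw [map_sub]; ring
    rw [e]
    refine Valuation.map_add_lt _ ?_ (hx p hp)
    have e2 : algebraMap R F m / algebraMap R F d - x p =
        algebraMap R F (m - n p) / algebraMap R F d := by
      rw [map_sub, hn p hp, Algebra.smul_def]
      field_simp
    rw [e2, map_div₀, map_div₀, valued_algebraMap_eq_intValuation,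
      valued_algebraMap_eq_intValuation, div_lt_iff₀ (hv p)]
    exact h1
  · rw [HeightOneSpectrum.mem_adicCompletionIntegers, map_div₀, map_div₀,
      valued_algebraMap_eq_intValuation, valued_algebraMap_eq_intValuation, div_le_iff₀ (hv p),
      one_mul]
    by_cases hpd : (d : R) ∈ p.asIdeal
    · have h1 := hm p (Finset.mem_union_right _ (by simp [hpd]))
      simp only [if_neg hp, sub_zero] at h1
      exact h1.le
    · rw [(p.intValuation_eq_one_iff).2 hpd]
      exact p.intValuation_le_one m

end StrongApproximation

section SLApproximation

open Matrix

variable {R : Type*} [CommRing R] [IsDedekindDomain R]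
  {F : Type*} [Field F] [Algebra R F] [IsFractionRing R F] {r : ℕ}

theorem SL_map_transvection {A B : Type*} [CommRing A] [CommRing B] (f : A →+* B) {i j : Fin r}
    (hij : i ≠ j) (a : A) :
    SpecialLinearGroup.map f (SpecialLinearGroup.transvection hij a) =
      SpecialLinearGroup.transvection hij (f a) := by
  apply Subtype.ext
  change (SpecialLinearGroup.transvection hij a).1.map f = _
  ext k l
  simp only [SpecialLinearGroup.transvection_coe, Matrix.map_apply, Matrix.add_apply,
    Matrix.one_apply, Matrix.single_apply, map_add, apply_ite f, map_one, map_zero]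

theorem continuous_SL_transvection {A : Type*} [CommRing A] [TopologicalSpace A]
    [IsTopologicalRing A] {i j : Fin r} (hij : i ≠ j) :
    Continuous fun a : A => (SpecialLinearGroup.transvection hij a) := by
  refine Topology.IsInducing.subtypeVal.continuous_iff.2 ?_
  refine continuous_matrix fun k l => ?_
  change Continuous fun a : A => (1 + Matrix.single i j a : Matrix (Fin r) (Fin r) A) k l
  simp only [Matrix.add_apply, Matrix.one_apply, Matrix.single_apply]
  by_cases h : i = k ∧ j = l
  · simp only [if_pos h]; exact continuous_const.add continuous_id
  · simp only [if_neg h]; exact continuous_const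

variable (F r) in
/-- Elements of `SL_r(F)` integral at all primes outside `T`. -/
noncomputable def integralOutside (T : Finset (HeightOneSpectrum R)) :
    Subgroup (SpecialLinearGroup (Fin r) F) :=
  ⨅ q : {q // q ∉ T}, (SpecialLinearGroup.map (n := Fin r)
      (algebraMap (q.1.adicCompletionIntegers F) (q.1.adicCompletion F))).range.comap
    (SpecialLinearGroup.map (algebraMap F (q.1.adicCompletion F)))

theorem mem_integralOutside {T : Finset (HeightOneSpectrum R)}
    {g : SpecialLinearGroup (Fin r) F} :
    g ∈ integralOutside F r T ↔ ∀ q ∉ T,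
      SpecialLinearGroup.map (algebraMap F (q.adicCompletion F)) g
      ∈ (SpecialLinearGroup.map (n := Fin r)
        (algebraMap (q.adicCompletionIntegers F) (q.adicCompletion F))).range := by
  simp only [integralOutside, Subgroup.mem_iInf, Subgroup.mem_comap, Subtype.forall]

/-- The diagonal embedding of `SL_r(F)`. -/
noncomputable def diagSL (T : Finset (HeightOneSpectrum R)) :
    SpecialLinearGroup (Fin r) F →* ∀ p : T, SpecialLinearGroup (Fin r) (p.1.adicCompletion F) :=
  MonoidHom.pi fun p => SpecialLinearGroup.map (algebraMap F (p.1.adicCompletion F))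

theorem transvection_mem_closure (T : Finset (HeightOneSpectrum R)) {i j : Fin r} (hij : i ≠ j)
    (b : ∀ p : T, p.1.adicCompletion F) :
    (fun p : T => SpecialLinearGroup.transvection hij (b p)) ∈
      ((integralOutside F r T).map (diagSL T)).topologicalClosure := by
  classical
  let φ (b : ∀ p : T, p.1.adicCompletion F) :
      ∀ p : T, SpecialLinearGroup (Fin r) (p.1.adicCompletion F) :=
    fun p => SpecialLinearGroup.transvection hij (b p)
  have hφ : Continuous φ :=
    continuous_pi fun p => (continuous_SL_transvection hij).comp (continuous_apply p)
  let D : Set (∀ p : T, p.1.adicCompletion F) := {b | ∃ x : F,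
    (∀ q ∉ T, algebraMap F (q.adicCompletion F) x ∈ q.adicCompletionIntegers F) ∧
      b = fun p : T => algebraMap F (p.1.adicCompletion F) x}
  have hD : b ∈ closure D := by
    rw [mem_closure_iff_nhds]
    intro s hs
    rw [nhds_pi, Filter.mem_pi] at hs
    obtain ⟨I, -, t, ht, hts⟩ := hs
    choose γ hγ hγt using fun p => (adic_mem_nhds p.1).1 (ht p)
    obtain ⟨x, hx, hxT⟩ := exists_strong_approx T
      (fun p => if h : p ∈ T then b ⟨p, h⟩ else 0) (fun p => if h : p ∈ T then γ ⟨p, h⟩ else 1)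
      (fun p hp => by simpa [hp] using hγ ⟨p, hp⟩)
    refine ⟨fun p => algebraMap F (p.1.adicCompletion F) x, hts fun p _ => hγt p ?_, x, hxT, rfl⟩
    simpa using hx p.1 p.2
  have h1 : φ b ∈ closure (φ '' D) := image_closure_subset_closure_image hφ ⟨b, hD, rfl⟩
  refine closure_mono ?_ h1
  rintro _ ⟨_, ⟨x, hx, rfl⟩, rfl⟩
  refine ⟨SpecialLinearGroup.transvection hij x, mem_integralOutside.2 fun q hq => ?_, ?_⟩
  · refine ⟨SpecialLinearGroup.transvection hij ⟨_, hx q hq⟩, ?_⟩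
    rw [SL_map_transvection, SL_map_transvection]
    rfl
  · funext p
    exact SL_map_transvection _ hij x

/-- Strong approximation for `SL_r`. -/
theorem exists_SL_strong_approx (hr : 2 ≤ r) (T : Finset (HeightOneSpectrum R))
    (k : ∀ p : HeightOneSpectrum R, SpecialLinearGroup (Fin r) (p.adicCompletion F))
    {U : ∀ p : HeightOneSpectrum R, Set (SpecialLinearGroup (Fin r) (p.adicCompletion F))}
    (hU : ∀ p ∈ T, U p ∈ nhds (k p)) :
    ∃ g ∈ integralOutside F r T,
      ∀ p ∈ T, SpecialLinearGroup.map (algebraMap F (p.adicCompletion F)) g ∈ U p := by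
  classical
  have : Nontrivial (Fin r) := Fin.nontrivial_iff_two_le.2 hr
  set H := ((integralOutside F r T).map (diagSL T)).topologicalClosure with hH
  have hsingle (p : T) (g : SpecialLinearGroup (Fin r) (p.1.adicCompletion F)) :
      Pi.mulSingle p g ∈ H := by
    refine SpecialLinearGroup_transvection_induction (fun g => Pi.mulSingle p g ∈ H) g
      (fun i j hij a => ?_) (fun A B hA hB => ?_)
    · have := transvection_mem_closure T hij (Pi.single p a)
      convert! this using 1
      funext q
      by_cases hq : q = p
      · subst hq; simp
      · rw [Pi.mulSingle_eq_of_ne hq, Pi.single_eq_of_ne hq,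
          SpecialLinearGroup.transvection_coeff_zero]
    · rw [Pi.mulSingle_mul]
      exact mul_mem hA hB
  have hk : (fun p : T => k p.1) ∈ H := Subgroup.pi_mem_of_mulSingle_mem _ fun p => hsingle p _
  have hk' : (fun p : T => k p.1) ∈ closure
    (((integralOutside F r T).map (diagSL T) : Subgroup _) : Set _) := hk
  rw [mem_closure_iff_nhds] at hk'
  obtain ⟨_, hy, g, hg, rfl⟩ := hk' (Set.univ.pi fun p : T => U p.1)
    (set_pi_mem_nhds Set.finite_univ fun p _ => hU p.1 p.2)
  exact ⟨g, hg, fun p hp => hy ⟨p, hp⟩ (Set.mem_univ _)⟩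

end SLApproximation

section LocalGlobal

variable {R : Type*} [CommRing R] [IsDedekindDomain R]
  {F : Type*} [Field F] [Algebra R F] [IsFractionRing R F] {r : ℕ}

theorem finite_setOf_not_embVec_integral (x : Fin r → F) :
    {p : HeightOneSpectrum R | ¬ ∀ i, embVec R F p x i ∈ p.adicCompletionIntegers F}.Finite := by
  refine (Set.finite_iUnion fun i => HeightOneSpectrum.Support.finite R (x i)).subset ?_
  intro p hp
  obtain ⟨i, hi⟩ := not_forall.1 hp
  refine Set.mem_iUnion.2 ⟨i, ?_⟩
  change 1 < p.valuation F (x i)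
  rw [← HeightOneSpectrum.valuedAdicCompletion_eq_valuation']
  exact not_le.1 hi

theorem finite_setOf_mulGL_embGL_ne (γ : GL (Fin r) F) :
    {p : HeightOneSpectrum R | mulGL (affLat (p.adicCompletionIntegers F) 0 1) (embGL R F p γ) ≠
      affLat (p.adicCompletionIntegers F) 0 1}.Finite := by
  have h1 (γ : GL (Fin r) F) : {p : HeightOneSpectrum R |
      ¬ ∀ i j, (embGL R F p γ).1 i j ∈ p.adicCompletionIntegers F}.Finite := by
    refine (Set.finite_iUnion fun i => finite_setOf_not_embVec_integral (γ.1 i)).subset ?_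
    intro p hp
    obtain ⟨i, hi⟩ := not_forall.1 hp
    exact Set.mem_iUnion.2 ⟨i, hi⟩
  have h2 {p : HeightOneSpectrum R} {g : GL (Fin r) (p.adicCompletion F)}
      (hg : ∀ i j, g.1 i j ∈ p.adicCompletionIntegers F) :
      mulGL (affLat (p.adicCompletionIntegers F) 0 1) g ⊆
        affLat (p.adicCompletionIntegers F) 0 1 :=
    mulGL_affLat_subset (by simpa using hg) (by simp)
  refine ((h1 γ).union (h1 γ⁻¹)).subset fun p hp => ?_
  by_contra hcon
  obtain ⟨ha, hb⟩ := not_or.1 hcon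
  exact hp (mulGL_eq_of_subset (h2 (not_not.1 ha)) (h2 (not_not.1 hb)))

theorem exists_smul_mem_of_mem_span {M : Submodule R (Fin r → F)} {x : Fin r → F}
    (hx : x ∈ Submodule.span F (M : Set (Fin r → F))) : ∃ d : R, d ≠ 0 ∧ d • x ∈ M := by
  induction hx using Submodule.span_induction with
  | mem x hx => exact ⟨1, one_ne_zero, by simpa using hx⟩
  | zero => exact ⟨1, one_ne_zero, by simp⟩
  | add x y _ _ hx hy =>
    obtain ⟨d, hd, hdx⟩ := hx
    obtain ⟨e, he, hey⟩ := hy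
    refine ⟨d * e, mul_ne_zero hd he, ?_⟩
    rw [smul_add, mul_smul, mul_smul, smul_comm d e x]
    exact M.add_mem (M.smul_mem _ hdx) (M.smul_mem _ hey)
  | smul a x _ hx =>
    obtain ⟨d, hd, hdx⟩ := hx
    obtain ⟨⟨n, m, hm⟩, hnm⟩ := IsLocalization.surj (nonZeroDivisors R) a
    have hnm : a * algebraMap R F m = algebraMap R F n := hnm
    refine ⟨m * d, mul_ne_zero (nonZeroDivisors.ne_zero hm) hd, ?_⟩
    have : (m * d) • a • x = n • d • x := by
      funext i
      simp only [Pi.smul_apply, smul_eq_mul, Algebra.smul_def (R := R) (A := F), map_mul, ← hnm]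
      ring
    rw [this]
    exact M.smul_mem _ hdx

/-- A full lattice contains `d R^r` for some nonzero `d`. -/
theorem exists_smul_standard_le {M : Submodule R (Fin r → F)}
    (hspan : Submodule.span F (M : Set (Fin r → F)) = ⊤) :
    ∃ d : R, d ≠ 0 ∧ ∀ n : Fin r → R, d • (fun i => algebraMap R F (n i)) ∈ M := by
  classical
  choose d hd hdM using fun i : Fin r => exists_smul_mem_of_mem_span (M := M)
    (x := Pi.single i (1 : F)) (hspan ▸ Submodule.mem_top)
  refine ⟨∏ i, d i, Finset.prod_ne_zero_iff.2 fun i _ => hd i, fun n => ?_⟩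
  have : (fun i => algebraMap R F (n i)) = ∑ i, n i • (Pi.single i (1 : F) : Fin r → F) := by
    funext j
    simp [Finset.sum_apply, Pi.single_apply, Algebra.smul_def]
  rw [this, Finset.smul_sum]
  refine M.sum_mem fun i _ => ?_
  obtain ⟨e, he⟩ := Finset.dvd_prod_of_mem d (Finset.mem_univ i)
  rw [smul_comm, he, mul_comm, mul_smul]
  exact M.smul_mem _ (M.smul_mem _ (hdM i))

theorem finite_setOf_locCl_ne {M : Submodule R (Fin r → F)} (hfg : M.FG)
    (hspan : Submodule.span F (M : Set (Fin r → F)) = ⊤) :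
    {p : HeightOneSpectrum R | locCl R F p (M : Set (Fin r → F)) ≠
      affLat (p.adicCompletionIntegers F) 0 1}.Finite := by
  classical
  obtain ⟨d, hd0, hd⟩ := exists_smul_standard_le hspan
  obtain ⟨S, hS⟩ := id hfg
  have hfin := S.finite_toSet.biUnion fun x _ => finite_setOf_not_embVec_integral (R := R) x
  refine ((finite_setOf_mem_asIdeal hd0).union hfin).subset fun p hp => ?_
  by_contra hcon
  obtain ⟨hpd, hpS⟩ := not_or.1 hcon
  refine hp (subset_antisymm ?_ ?_)
  · refine closure_minimal ?_ (isClosed_affLat 0 1)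
    rintro _ ⟨x, hx, rfl⟩
    rw [← hS] at hx
    refine mem_affLat_zero_one.2 ?_
    beta_reduce
    induction hx using Submodule.span_induction with
    | mem x hx =>
      by_contra h
      exact hpS (Set.mem_biUnion hx h)
    | zero => intro i; simp [embVec]
    | add x y _ _ hx hy => intro i; rw [embVec_add]; exact add_mem (hx i) (hy i)
    | smul a x _ hx =>
      intro i
      have := mul_mem (algebraMap_mem_adicCompletionIntegers (F := F) p a) (hx i)
      convert! this using 1
      simp [embVec, Algebra.smul_def]
  · obtain ⟨h, hh⟩ := exists_locCl_eq_affLat p hfg hspan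
    rw [hh]
    intro z hz
    have hz' := mem_affLat_zero_one.1 hz
    have hinv (j i) : (h⁻¹).1 j i ∈ p.adicCompletionIntegers F := by
      have h1 := subset_locCl (R := R) p (hd (Pi.single j 1))
      rw [hh] at h1
      have h2 := h1 i
      have e : embVec R F p (d • fun i => algebraMap R F ((Pi.single j 1 : Fin r → R) i)) =
          algebraMap F (p.adicCompletion F) (algebraMap R F d) • Pi.single j 1 := by
        funext k
        by_cases hk : k = j
        · subst hk; simp [embVec, Algebra.smul_def]
        · simp [embVec, hk]
      rw [sub_zero, e, Matrix.smul_vecMul, Pi.smul_apply, Matrix.single_one_vecMul,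
        smul_eq_mul, HeightOneSpectrum.mem_adicCompletionIntegers, map_mul,
        valued_algebraMap_eq_intValuation, (p.intValuation_eq_one_iff).2 hpd, one_mul] at h2
      exact h2
    intro i
    rw [sub_zero]
    exact vecMul_mem hz' hinv i

theorem mem_of_forall_mem_locCl {M : Submodule R (Fin r → F)}
    (hspan : Submodule.span F (M : Set (Fin r → F)) = ⊤) {x : Fin r → F}
    (hx : ∀ p : HeightOneSpectrum R, embVec R F p x ∈ locCl R F p (M : Set (Fin r → F))) :
    x ∈ M := by
  obtain ⟨d, hd0, hd⟩ := exists_smul_standard_le hspan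
  have hdF : algebraMap R F d ≠ 0 := by simpa using hd0
  set J : Ideal R := M.comap (LinearMap.toSpanSingleton R (Fin r → F) x) with hJ
  have hJmem (a : R) : a ∈ J ↔ a • x ∈ M := by simp [hJ]
  suffices J = ⊤ by
    have := (hJmem 1).1 (this ▸ Submodule.mem_top)
    simpa using this
  by_contra hne
  obtain ⟨m, hm, hJm⟩ := Ideal.exists_le_maximal J hne
  have hm0 : m ≠ ⊥ := by
    obtain ⟨e, he, heM⟩ := exists_smul_mem_of_mem_span (M := M) (x := x)
      (hspan ▸ Submodule.mem_top)
    rintro rfl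
    exact he (hJm ((hJmem e).2 heM))
  let p : HeightOneSpectrum R := ⟨m, hm.isPrime, hm0⟩
  set δ := algebraMap F (p.adicCompletion F) (algebraMap R F d) with hδ
  have hδ0 : δ ≠ 0 := by simpa [hδ] using hd0
  have hU : {y : Fin r → p.adicCompletion F | ∀ i, (y i - embVec R F p x i) * δ⁻¹ ∈
      p.adicCompletionIntegers F} ∈ nhds (embVec R F p x) := by
    have : {y : Fin r → p.adicCompletion F | ∀ i, (y i - embVec R F p x i) * δ⁻¹ ∈
        p.adicCompletionIntegers F} = ⋂ i, (fun y : Fin r → p.adicCompletion F =>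
          (y i - embVec R F p x i) * δ⁻¹) ⁻¹' (p.adicCompletionIntegers F) := by
      ext; simp
    refine IsOpen.mem_nhds ?_ (by simp)
    rw [this]
    refine isOpen_iInter_of_finite fun i => (isOpen_adicCompletionIntegers p).preimage ?_
    exact ((continuous_apply i).sub continuous_const).mul continuous_const
  obtain ⟨_, hy, y, hyM, rfl⟩ := mem_closure_iff_nhds.1 (hx p) _ hU
  have hint (i) : p.valuation F ((y i - x i) * (algebraMap R F d)⁻¹) ≤ 1 := by
    rw [← HeightOneSpectrum.valuedAdicCompletion_eq_valuation']
    have := hy i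
    rw [HeightOneSpectrum.mem_adicCompletionIntegers] at this
    convert! this using 2
    change algebraMap F (p.adicCompletion F) ((y i - x i) * (algebraMap R F d)⁻¹) = _
    rw [map_mul, map_sub, map_inv₀]
    rfl
  choose n s hns using fun i =>
    HeightOneSpectrum.exists_primeCompl_mul_eq_of_integer p _ (hint i)
  let t : R := ∏ i, (s i : R)
  have ht : t ∉ m := by
    have : t ∈ p.asIdeal.primeCompl := prod_mem fun i _ => (s i).2
    exact this
  have hty : t • (y - x) ∈ M := by
    choose e he using fun i => Finset.dvd_prod_of_mem (fun i => (s i : R)) (Finset.mem_univ i)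
    have : t • (y - x) = d • (fun i => algebraMap R F (e i * n i)) := by
      funext i
      have h1 : t = s i * e i := he i
      simp only [Pi.smul_apply, Pi.sub_apply, Algebra.smul_def, h1, map_mul, ← hns i]
      field_simp
    rw [this]
    exact hd _
  refine ht (hJm ((hJmem t).2 ?_))
  have := M.sub_mem (M.smul_mem t hyM) hty
  rwa [smul_sub, sub_sub_cancel] at this

theorem mem_mulGL_cosetOf_iff {M : Submodule R (Fin r → F)}
    (hspan : Submodule.span F (M : Set (Fin r → F)) = ⊤) (c : Fin r → F) (γ : GL (Fin r) F)
    {x : Fin r → F} :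
    x ∈ mulGL (cosetOf c (M : Set (Fin r → F))) γ ↔ ∀ p : HeightOneSpectrum R,
      embVec R F p x ∈ locCl R F p (mulGL (cosetOf c (M : Set (Fin r → F))) γ) := by
  refine ⟨fun h p => subset_locCl p h, fun h => mem_mulGL_iff.2 ?_⟩
  refine mem_of_forall_mem_locCl hspan fun p => ?_
  have := h p
  rw [locCl_mulGL, mem_mulGL_iff, locCl_cosetOf] at this
  rw [embVec_sub, embVec_vecMul]
  exact this

end LocalGlobal

section FiniteQuotients

theorem finite_quotient_span_algebraMap {A K S E : Type*} [CommRing A] [IsDomain A]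
    [IsPrincipalIdealRing A] [Ring.HasFiniteQuotients A] [Field K] [Algebra A K]
    [IsFractionRing A K] [Field E] [Algebra K E] [FiniteDimensional K E] [Algebra A E]
    [IsScalarTower A K E] [CommRing S] [Algebra A S] [Algebra S E] [IsScalarTower A S E]
    (hinj : Function.Injective (algebraMap S E)) {f : A} (hf : f ≠ 0) :
    Finite (S ⧸ Ideal.span {algebraMap A S f}) := by
  classical
  set I := Ideal.span {algebraMap A S f} with hI
  have hfin : Finite (A ⧸ Ideal.span {f}) :=
    Ring.HasFiniteQuotients.finiteQuotient (by simpa using hf)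
  have : Fintype (A ⧸ Ideal.span {f}) := Fintype.ofFinite _
  have hAE : Function.Injective (algebraMap A E) := by
    rw [IsScalarTower.algebraMap_eq A K E]
    exact (algebraMap K E).injective.comp (IsFractionRing.injective A K)
  have hAS : Function.Injective (algebraMap A S) := by
    rw [IsScalarTower.algebraMap_eq A S E] at hAE
    exact Function.Injective.of_comp hAE
  have : IsDomain S := hinj.isDomain (algebraMap S E)
  have : Module.IsTorsionFree A S := by
    rw [Module.isTorsionFree_iff_algebraMap_injective]
    exact hAS
  set q := Fintype.card (A ⧸ Ideal.span {f})
  by_contra hinf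
  rw [not_finite_iff_infinite] at hinf
  obtain ⟨s, hs⟩ := Infinite.exists_subset_card_eq (S ⧸ I) (q ^ Module.finrank K E + 1)
  let M := Submodule.span A ((Quotient.out : S ⧸ I → S) '' s)
  have : Module.Finite A M := Module.Finite.span_of_finite A (s.finite_toSet.image _)
  let b := Module.Free.chooseBasis A M
  have hli : LinearIndependent A fun i => algebraMap S E (b i : S) := by
    have h1 : LinearIndependent A fun i => (b i : S) :=
      b.linearIndependent.map' M.subtype (Submodule.ker_subtype M)
    exact h1.map' (IsScalarTower.toAlgHom A S E).toLinearMap (LinearMap.ker_eq_bot.2 hinj)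
  have hcard := ((LinearIndependent.iff_fractionRing A K).1 hli).fintype_card_le_finrank
  let c (x : s) : M := ⟨Quotient.out x.1, Submodule.subset_span ⟨x.1, x.2, rfl⟩⟩
  let Φ (x : s) : Module.Free.ChooseBasisIndex A M → A ⧸ Ideal.span {f} :=
    fun i => Ideal.Quotient.mk _ (b.repr (c x) i)
  have hΦ : Function.Injective Φ := by
    intro x y hxy
    have h1 (i) : ∃ d, b.repr (c x) i - b.repr (c y) i = f * d :=
      Ideal.mem_span_singleton.1 (Ideal.Quotient.eq.1 (congrFun hxy i))
    choose d hd using h1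
    have h2 : c x - c y = f • ∑ i, d i • b i := by
      rw [← b.sum_repr (c x - c y), Finset.smul_sum]
      refine Finset.sum_congr rfl fun i _ => ?_
      rw [map_sub, Finsupp.sub_apply, hd, mul_smul]
    have h3 : (Quotient.out x.1 : S) - Quotient.out y.1 ∈ I := by
      have := congrArg (fun m : M => (m : S)) h2
      simp only [Submodule.coe_sub, Submodule.coe_smul, Algebra.smul_def f] at this
      exact Ideal.mem_span_singleton.2 ⟨_, this⟩
    have h4 := Ideal.Quotient.eq.2 h3
    apply Subtype.ext
    rw [← Quotient.out_eq x.1, ← Quotient.out_eq y.1]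
    exact h4
  have h5 := Fintype.card_le_of_injective Φ hΦ
  rw [Fintype.card_coe, hs, Fintype.card_fun] at h5
  have h6 : q ^ Fintype.card (Module.Free.ChooseBasisIndex A M) ≤ q ^ Module.finrank K E :=
    Nat.pow_le_pow_right Fintype.card_pos hcard
  exact Nat.lt_irrefl _ (h5.trans h6)

instance hasFiniteQuotients_polynomial (k : Type*) [Field k] [Finite k] :
    Ring.HasFiniteQuotients (Polynomial k) where
  finiteQuotient {I} hI := by
    obtain ⟨f, rfl⟩ := (IsPrincipalIdealRing.principal I).principal
    have hf : f ≠ 0 := by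
      rintro rfl
      simp at hI
    have : Module.Finite k (AdjoinRoot f) := (AdjoinRoot.powerBasis hf).finite
    exact Module.finite_of_finite k (M := AdjoinRoot f)

theorem hasFiniteQuotients_integralClosure (A K E : Type*) [CommRing A] [IsDomain A]
    [IsPrincipalIdealRing A] [Ring.HasFiniteQuotients A] [Field K] [Algebra A K]
    [IsFractionRing A K] [Field E] [Algebra K E] [FiniteDimensional K E] [Algebra A E]
    [IsScalarTower A K E] : Ring.HasFiniteQuotients (integralClosure A E) where
  finiteQuotient {I} hI := by
    have h1 : I.under A ≠ ⊥ := Ideal.under_ne_bot A hI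
    obtain ⟨f, hfI, hf⟩ := Submodule.exists_mem_ne_zero_of_ne_bot h1
    have := finite_quotient_span_algebraMap (K := K) (S := integralClosure A E) (E := E)
      Subtype.val_injective hf
    exact Finite.of_surjective _ (Ideal.Quotient.factor_surjective
      ((Ideal.span_singleton_le_iff_mem I).2 hfI))

end FiniteQuotients

section OrbitProduct

open Matrix

theorem cosetOf_affLat {Q : Type*} [Field Q] {r : ℕ} {O : ValuationSubring Q} (c : Fin r → Q)
    (h : GL (Fin r) Q) : cosetOf c (affLat O 0 h) = affLat O c h := by
  ext z
  simp [cosetOf, affLat]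

variable {R : Type*} [CommRing R] [IsDedekindDomain R]
  {F : Type*} [Field F] [Algebra R F] [IsFractionRing R F] {r : ℕ}

variable (R) in
/-- The local properties of a coset of a full `R`-lattice. -/
structure IsLatticeCoset (X : Set (Fin r → F)) : Prop where
  mem_mulGL_iff (γ : GL (Fin r) F) (x : Fin r → F) : x ∈ mulGL X γ ↔
    ∀ p : HeightOneSpectrum R, embVec R F p x ∈ mulGL (locCl R F p X) (embGL R F p γ)
  locCl_eq (p : HeightOneSpectrum R) :
    ∃ c h, locCl R F p X = affLat (p.adicCompletionIntegers F) c h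
  finite_ne : {p : HeightOneSpectrum R |
    locCl R F p X ≠ affLat (p.adicCompletionIntegers F) 0 1}.Finite

theorem isLatticeCoset_imDelta {M : Submodule R (Fin r → F)} (hfg : M.FG)
    (hspan : Submodule.span F (M : Set (Fin r → F)) = ⊤) (v : Fin r → F) (δ : GL (Fin r) F) :
    IsLatticeCoset R (imDelta v (M : Set (Fin r → F)) δ) where
  mem_mulGL_iff γ x := by
    change x ∈ mulGL (mulGL (cosetOf v (M : Set (Fin r → F))) δ) γ ↔
      ∀ p, _ ∈ mulGL (locCl R F p (mulGL (cosetOf v (M : Set (Fin r → F))) δ)) _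
    simp only [← locCl_mulGL, ← mulGL_mul]
    exact mem_mulGL_cosetOf_iff hspan v _
  locCl_eq p := by
    obtain ⟨h, hh⟩ := exists_locCl_eq_affLat p hfg hspan
    refine ⟨vecMul (embVec R F p v) (embGL R F p δ).1, h * embGL R F p δ, ?_⟩
    change locCl R F p (mulGL (cosetOf v (M : Set (Fin r → F))) δ) = _
    rw [locCl_mulGL, locCl_cosetOf, hh, cosetOf_affLat, mulGL_affLat]
  finite_ne := by
    refine (((finite_setOf_locCl_ne hfg hspan).union
      (finite_setOf_not_embVec_integral v)).union (finite_setOf_mulGL_embGL_ne δ)).subset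
      fun p hp => ?_
    by_contra hcon
    obtain ⟨hcon, h3⟩ := not_or.1 hcon
    obtain ⟨h1, h2⟩ := not_or.1 hcon
    refine hp ?_
    change locCl R F p (mulGL (cosetOf v (M : Set (Fin r → F))) δ) = _
    rw [locCl_mulGL, locCl_cosetOf, not_not.1 h1, cosetOf_affLat,
      ← affLat_eq_of_mem (mem_affLat_zero_one.2 (not_not.1 h2))]
    exact not_not.1 h3

theorem imDelta_one {Q : Type*} [Field Q] (v : Fin r → Q) (M : Set (Fin r → Q)) :
    imDelta v M 1 = cosetOf v M :=
  mulGL_one _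

variable {X X' : Set (Fin r → F)}

theorem IsLatticeCoset.mulGL_eq (hX : IsLatticeCoset R X) {γ γ' : GL (Fin r) F}
    (h : ∀ p : HeightOneSpectrum R, mulGL (locCl R F p X) (embGL R F p γ) =
      mulGL (locCl R F p X) (embGL R F p γ')) : mulGL X γ = mulGL X γ' := by
  ext x
  rw [hX.mem_mulGL_iff, hX.mem_mulGL_iff]
  simp only [h]

theorem locCl_mem_orbSet (p : HeightOneSpectrum R) {x : Fin r → F} {Z : Set (Fin r → F)}
    (hZ : Z ∈ orbSet X X' x) :
    locCl R F p Z ∈ orbSet (locCl R F p X) (locCl R F p X') (embVec R F p x) := by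
  obtain ⟨γ, hγ, rfl, hx⟩ := hZ
  refine ⟨embGL R F p γ, ?_, locCl_mulGL p X γ, subset_locCl p hx⟩
  rw [← locCl_mulGL, hγ]

theorem orbSet_eq_singleton {Q : Type*} [Field Q] {X X' : Set (Fin r → Q)} (h : X = X')
    {x : Fin r → Q} (hx : x ∈ X) : orbSet X X' x = {X} := by
  subst h
  ext Z
  constructor
  · rintro ⟨k, hk, rfl, -⟩
    exact hk
  · rintro rfl
    exact ⟨1, mulGL_one _, (mulGL_one _).symm, hx⟩

theorem locCl_bijective (hr : 2 ≤ r) (hX : IsLatticeCoset R X) (hX' : IsLatticeCoset R X')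
    (hdet : ∀ (p : HeightOneSpectrum R) (k : GL (Fin r) (p.adicCompletion F)),
      mulGL (locCl R F p X') k = locCl R F p X' → ∃ k₁ : GL (Fin r) (p.adicCompletion F),
        k₁.1.det = 1 ∧ mulGL (locCl R F p X') k₁ = locCl R F p X' ∧
        mulGL (locCl R F p X) k₁ = mulGL (locCl R F p X) k)
    {x : Fin r → F} {T : Finset (HeightOneSpectrum R)}
    (hT : ∀ p ∉ T, locCl R F p X = affLat (p.adicCompletionIntegers F) 0 1)
    (hT' : ∀ p ∉ T, locCl R F p X' = affLat (p.adicCompletionIntegers F) 0 1)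
    (hTx : ∀ p ∉ T, embVec R F p x ∈ affLat (p.adicCompletionIntegers F) 0 1) :
    Function.Bijective fun (Z : orbSet X X' x) (p : T) =>
      (⟨locCl R F p.1 Z.1, locCl_mem_orbSet p.1 Z.2⟩ :
        orbSet (locCl R F p.1 X) (locCl R F p.1 X') (embVec R F p.1 x)) := by
  constructor
  · rintro ⟨_, γ, hγ, rfl, h1⟩ ⟨_, γ', hγ', rfl, h2⟩ h
    apply Subtype.ext
    refine hX.mulGL_eq fun p => ?_
    by_cases hp : p ∈ T
    · have := congrArg Subtype.val (congrFun h ⟨p, hp⟩)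
      simpa only [locCl_mulGL] using this
    · rw [hT p hp, ← hT' p hp, ← locCl_mulGL, ← locCl_mulGL, hγ, hγ']
  · intro Z
    have hs (p : HeightOneSpectrum R) : ∃ s : SpecialLinearGroup (Fin r) (p.adicCompletion F),
        ∀ hp : p ∈ T, mulGL (locCl R F p X') (SpecialLinearGroup.toGL s) = locCl R F p X' ∧
          (Z ⟨p, hp⟩).1 = mulGL (locCl R F p X) (SpecialLinearGroup.toGL s) := by
      by_cases hp : p ∈ T
      · obtain ⟨k, hk, hZ, -⟩ := (Z ⟨p, hp⟩).2
        obtain ⟨k₁, h1, h2, h3⟩ := hdet p k hk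
        have e : SpecialLinearGroup.toGL ⟨k₁.1, h1⟩ = k₁ := Units.ext rfl
        exact ⟨⟨k₁.1, h1⟩, fun _ => by rw [e, h2, h3]; exact ⟨rfl, hZ⟩⟩
      · exact ⟨1, fun h => absurd h hp⟩
    choose s hs using hs
    have hev {Y : Set (Fin r → F)} (hY : IsLatticeCoset R Y) (p : HeightOneSpectrum R) :
        ∀ᶠ g in nhds (s p), mulGL (locCl R F p Y) (SpecialLinearGroup.toGL g) =
          mulGL (locCl R F p Y) (SpecialLinearGroup.toGL (s p)) := by
      obtain ⟨c, h, e⟩ := hY.locCl_eq p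
      rw [e]
      exact (SpecialLinearGroup.continuous_toGL.tendsto (s p)).eventually
        (eventually_mulGL_affLat_eq c h _)
    obtain ⟨g, hg, hgT⟩ := exists_SL_strong_approx hr T s
      (fun p _ => (hev hX p).and (hev hX' p))
    have hemb (p : HeightOneSpectrum R) : embGL R F p (SpecialLinearGroup.toGL g) =
        SpecialLinearGroup.toGL (SpecialLinearGroup.map (algebraMap F (p.adicCompletion F)) g) :=
      Units.ext rfl
    have hstd (p) (hp : p ∉ T) : mulGL (affLat (p.adicCompletionIntegers F) 0 1)
        (embGL R F p (SpecialLinearGroup.toGL g)) = affLat (p.adicCompletionIntegers F) 0 1 := by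
      refine mulGL_standard_of_mem_range _ ?_
      obtain ⟨g', hg'⟩ := mem_integralOutside.1 hg p hp
      rw [hemb, ← hg']
      exact ⟨SpecialLinearGroup.toGL g', Units.ext rfl⟩
    have hloc' (p) : mulGL (locCl R F p X') (embGL R F p (SpecialLinearGroup.toGL g)) =
        locCl R F p X' := by
      by_cases hp : p ∈ T
      · rw [hemb, (hgT p hp).2, (hs p hp).1]
      · rw [hT' p hp, hstd p hp]
    have hloc (p) (hp : p ∈ T) : mulGL (locCl R F p X)
        (embGL R F p (SpecialLinearGroup.toGL g)) = (Z ⟨p, hp⟩).1 := by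
      rw [hemb, (hgT p hp).1, (hs p hp).2]
    refine ⟨⟨mulGL X (SpecialLinearGroup.toGL g), SpecialLinearGroup.toGL g, ?_, rfl, ?_⟩, ?_⟩
    · have := hX'.mulGL_eq (γ := SpecialLinearGroup.toGL g) (γ' := 1) fun p => by
        rw [hloc' p, show embGL R F p (1 : GL (Fin r) F) = 1 from map_one _, mulGL_one]
      rwa [mulGL_one] at this
    · rw [hX.mem_mulGL_iff]
      intro p
      by_cases hp : p ∈ T
      · rw [hloc p hp]
        obtain ⟨_, -, -, hx⟩ := (Z ⟨p, hp⟩).2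
        exact hx
      · rw [hT p hp, hstd p hp]
        exact hTx p hp
    · funext p
      apply Subtype.ext
      change locCl R F p.1 (mulGL X _) = _
      rw [locCl_mulGL, hloc p.1 p.2]

theorem card_orbSet_eq_finprod [Ring.HasFiniteQuotients R] (hr : 2 ≤ r)
    (hX : IsLatticeCoset R X) (hX' : IsLatticeCoset R X')
    (hsub : ∀ p : HeightOneSpectrum R, locCl R F p X ⊆ locCl R F p X')
    (hdet : ∀ (p : HeightOneSpectrum R) (k : GL (Fin r) (p.adicCompletion F)),
      mulGL (locCl R F p X') k = locCl R F p X' → ∃ k₁ : GL (Fin r) (p.adicCompletion F),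
        k₁.1.det = 1 ∧ mulGL (locCl R F p X') k₁ = locCl R F p X' ∧
        mulGL (locCl R F p X) k₁ = mulGL (locCl R F p X) k) (x : Fin r → F) :
    (∀ p : HeightOneSpectrum R,
      (orbSet (locCl R F p X) (locCl R F p X') (embVec R F p x)).Finite) ∧
    {p : HeightOneSpectrum R |
      Nat.card (orbSet (locCl R F p X) (locCl R F p X') (embVec R F p x)) ≠ 1}.Finite ∧
    (orbSet X X' x).Finite ∧
    Nat.card (orbSet X X' x) = ∏ᶠ p : HeightOneSpectrum R,
      Nat.card (orbSet (locCl R F p X) (locCl R F p X') (embVec R F p x)) := by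
  have hfin (p : HeightOneSpectrum R) :
      (orbSet (locCl R F p X) (locCl R F p X') (embVec R F p x)).Finite := by
    obtain ⟨c, h, e⟩ := hX.locCl_eq p
    obtain ⟨c', h', e'⟩ := hX'.locCl_eq p
    have hs := hsub p
    rw [e, e'] at hs ⊢
    refine (finite_orbit_affLat hs).subset ?_
    rintro Z ⟨k, hk, hZ, -⟩
    exact ⟨k, hk, hZ⟩
  let T := ((hX.finite_ne.union hX'.finite_ne).union
    (finite_setOf_not_embVec_integral (R := R) x)).toFinset
  have hTout (p) (hp : p ∉ T) : locCl R F p X = affLat (p.adicCompletionIntegers F) 0 1 ∧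
      locCl R F p X' = affLat (p.adicCompletionIntegers F) 0 1 ∧
      embVec R F p x ∈ affLat (p.adicCompletionIntegers F) 0 1 := by
    rw [Set.Finite.mem_toFinset] at hp
    obtain ⟨hp, h3⟩ := not_or.1 hp
    obtain ⟨h1, h2⟩ := not_or.1 hp
    exact ⟨not_not.1 h1, not_not.1 h2, mem_affLat_zero_one.2 (not_not.1 h3)⟩
  have hsupp : {p : HeightOneSpectrum R |
      Nat.card (orbSet (locCl R F p X) (locCl R F p X') (embVec R F p x)) ≠ 1} ⊆ T := by
    intro p hp
    by_contra hpT
    obtain ⟨h1, h2, h3⟩ := hTout p hpT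
    refine hp ?_
    rw [orbSet_eq_singleton (h1.trans h2.symm) (h1 ▸ h3)]
    exact Nat.card_unique
  have hbij := locCl_bijective hr hX hX' hdet (x := x) (fun p hp => (hTout p hp).1)
    (fun p hp => (hTout p hp).2.1) (fun p hp => (hTout p hp).2.2)
  have (p : HeightOneSpectrum R) :
    Finite (orbSet (locCl R F p X) (locCl R F p X') (embVec R F p x)) := hfin p
  refine ⟨hfin, T.finite_toSet.subset hsupp, Finite.of_injective _ hbij.injective, ?_⟩
  rw [Nat.card_eq_of_bijective _ hbij, Nat.card_pi,
    finprod_eq_prod_of_mulSupport_subset _ hsupp]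
  exact Finset.prod_coe_sort T fun p =>
    Nat.card (orbSet (locCl R F p X) (locCl R F p X') (embVec R F p x))

theorem locCl_imDelta (p : HeightOneSpectrum R) (v : Fin r → F) (M : Set (Fin r → F))
    (δ : GL (Fin r) F) : locCl R F p (imDelta v M δ) =
      imDelta (embVec R F p v) (locCl R F p M) (embGL R F p δ) := by
  change locCl R F p (mulGL (cosetOf v M) δ) = mulGL _ _
  rw [locCl_mulGL, locCl_cosetOf]

theorem exists_det_one_of_lattice {L L' : Submodule R (Fin r → F)} (hLfg : L.FG)
    (hL'fg : L'.FG) (hLspan : Submodule.span F (L : Set (Fin r → F)) = ⊤)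
    (hL'span : Submodule.span F (L' : Set (Fin r → F)) = ⊤) (p : HeightOneSpectrum R)
    {v v' : Fin r → p.adicCompletion F} {δ k : GL (Fin r) (p.adicCompletion F)}
    (hA : imDelta v (locCl R F p (L : Set (Fin r → F))) δ ⊆
      cosetOf v' (locCl R F p (L' : Set (Fin r → F))))
    (hB : v ∉ locCl R F p (L : Set (Fin r → F)) →
      imDelta v (locCl R F p (L : Set (Fin r → F))) δ =
        cosetOf v' (locCl R F p (L' : Set (Fin r → F))))
    (hC : ¬ mulGL (locCl R F p (L : Set (Fin r → F))) δ ⊆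
      mIdealSMul R F p (locCl R F p (L' : Set (Fin r → F))))
    (hk : mulGL (cosetOf v' (locCl R F p (L' : Set (Fin r → F)))) k =
      cosetOf v' (locCl R F p (L' : Set (Fin r → F)))) :
    ∃ k₁ : GL (Fin r) (p.adicCompletion F), k₁.1.det = 1 ∧
      mulGL (cosetOf v' (locCl R F p (L' : Set (Fin r → F)))) k₁ =
        cosetOf v' (locCl R F p (L' : Set (Fin r → F))) ∧
      mulGL (imDelta v (locCl R F p (L : Set (Fin r → F))) δ) k₁ =
        mulGL (imDelta v (locCl R F p (L : Set (Fin r → F))) δ) k := by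
  by_cases hv : v ∈ locCl R F p (L : Set (Fin r → F))
  · obtain ⟨h, hh⟩ := exists_locCl_eq_affLat p hLfg hLspan
    obtain ⟨h', hh'⟩ := exists_locCl_eq_affLat p hL'fg hL'span
    have e : imDelta v (locCl R F p (L : Set (Fin r → F))) δ =
        affLat (p.adicCompletionIntegers F) 0 (h * δ) := by
      change mulGL (cosetOf _ _) _ = _
      rw [hh] at hv ⊢
      rw [cosetOf_affLat, ← affLat_eq_of_mem hv, mulGL_affLat, zero_vecMul]
    have hC' : mulGL (locCl R F p (L : Set (Fin r → F))) δ =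
        affLat (p.adicCompletionIntegers F) 0 (h * δ) := by
      rw [hh, mulGL_affLat, zero_vecMul]
    rw [hC', hh'] at hC
    rw [hh', cosetOf_affLat] at hA hk ⊢
    rw [e] at hA ⊢
    have e' := affLat_eq_of_mem (hA (mem_affLat_self 0 _))
    rw [e'] at hA hk ⊢
    exact exists_det_one_of_not_subset hA hC hk
  · rw [hB hv, hk]
    exact ⟨1, Matrix.det_one, mulGL_one _, mulGL_one _⟩

end OrbitProduct

/-- Lemma 14.4: local-global product formula `C(x) = ∏_p C_p(x)` for the
coset counts. -/
theorem coset_count_product_formula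
    (Fq : Type*) [Field Fq] [Fintype Fq]
    (F : Type*) [Field F] [Algebra (RatFunc Fq) F] [FiniteDimensional (RatFunc Fq) F]
    [Algebra (Polynomial Fq) F] [IsScalarTower (Polynomial Fq) (RatFunc Fq) F]
    [IsDedekindDomain ↥(integralClosure (Polynomial Fq) F)]
    [IsFractionRing ↥(integralClosure (Polynomial Fq) F) F]
    (r : ℕ) (hr : 2 ≤ r)
    (L L' : Submodule ↥(integralClosure (Polynomial Fq) F) (Fin r → F))
    (hLfg : L.FG) (hL'fg : L'.FG)
    (hLspan : Submodule.span F (L : Set (Fin r → F)) = ⊤)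
    (hL'span : Submodule.span F (L' : Set (Fin r → F)) = ⊤)
    (v0 v0' : Fin r → F) (δ : GL (Fin r) F)
    -- (a): `vδ + L_pδ ⊆ v′ + L′_p`
    (hA : ∀ p : HeightOneSpectrum ↥(integralClosure (Polynomial Fq) F),
      imDelta (embVec _ F p v0) (locCl _ F p (L : Set (Fin r → F))) (embGL _ F p δ) ⊆
        cosetOf (embVec _ F p v0') (locCl _ F p (L' : Set (Fin r → F))))
    -- (b): equality whenever `v ∉ L_p`
    (hB : ∀ p : HeightOneSpectrum ↥(integralClosure (Polynomial Fq) F),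
      embVec _ F p v0 ∉ locCl _ F p (L : Set (Fin r → F)) →
      imDelta (embVec _ F p v0) (locCl _ F p (L : Set (Fin r → F))) (embGL _ F p δ) =
        cosetOf (embVec _ F p v0') (locCl _ F p (L' : Set (Fin r → F))))
    -- (c): `L_pδ ⊄ 𝔪_p L′_p`
    (hC : ∀ p : HeightOneSpectrum ↥(integralClosure (Polynomial Fq) F),
      ¬ ((fun x => Matrix.vecMul x
          ((embGL _ F p δ : GL (Fin r) (p.adicCompletion F)) :
            Matrix (Fin r) (Fin r) (p.adicCompletion F))) ''
          locCl _ F p (L : Set (Fin r → F)) ⊆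
        mIdealSMul _ F p (locCl _ F p (L' : Set (Fin r → F))))) :
    -- `vδγ + Lδγ` depends only on the coset `Γγ`
    (∀ γ1 γ2 : GL (Fin r) F, StabSet (cosetOf v0' (L' : Set (Fin r → F))) γ1 →
      StabSet (cosetOf v0' (L' : Set (Fin r → F))) γ2 →
      (∃ g, KPred v0 v0' (L : Set (Fin r → F)) (L' : Set (Fin r → F)) δ g ∧ γ1 = g * γ2) →
      (fun y => Matrix.vecMul y (γ1 : Matrix (Fin r) (Fin r) F)) ''
          imDelta v0 (L : Set (Fin r → F)) δ =
        (fun y => Matrix.vecMul y (γ2 : Matrix (Fin r) (Fin r) F)) ''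
          imDelta v0 (L : Set (Fin r → F)) δ) ∧
    -- `vδk + (L_pδ)k` depends only on the coset `K_p k`
    (∀ p : HeightOneSpectrum ↥(integralClosure (Polynomial Fq) F),
      ∀ k1 k2 : GL (Fin r) (p.adicCompletion F),
      StabSet (cosetOf (embVec _ F p v0') (locCl _ F p (L' : Set (Fin r → F)))) k1 →
      StabSet (cosetOf (embVec _ F p v0') (locCl _ F p (L' : Set (Fin r → F)))) k2 →
      (∃ g, KPred (embVec _ F p v0) (embVec _ F p v0')
          (locCl _ F p (L : Set (Fin r → F))) (locCl _ F p (L' : Set (Fin r → F)))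
          (embGL _ F p δ) g ∧ k1 = g * k2) →
      (fun y => Matrix.vecMul y (k1 : Matrix (Fin r) (Fin r) (p.adicCompletion F))) ''
          imDelta (embVec _ F p v0) (locCl _ F p (L : Set (Fin r → F))) (embGL _ F p δ) =
        (fun y => Matrix.vecMul y (k2 : Matrix (Fin r) (Fin r) (p.adicCompletion F))) ''
          imDelta (embVec _ F p v0) (locCl _ F p (L : Set (Fin r → F))) (embGL _ F p δ)) ∧
    -- finiteness and the product formula
    (∀ x : Fin r → F,
      (∀ p : HeightOneSpectrum ↥(integralClosure (Polynomial Fq) F),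
        (countSet (embVec _ F p v0) (embVec _ F p v0')
          (locCl _ F p (L : Set (Fin r → F))) (locCl _ F p (L' : Set (Fin r → F)))
          (embGL _ F p δ) (embVec _ F p x)).Finite) ∧
      {p : HeightOneSpectrum ↥(integralClosure (Polynomial Fq) F) |
        Nat.card (countSet (embVec _ F p v0) (embVec _ F p v0')
          (locCl _ F p (L : Set (Fin r → F))) (locCl _ F p (L' : Set (Fin r → F)))
          (embGL _ F p δ) (embVec _ F p x)) ≠ 1}.Finite ∧
      (countSet v0 v0' (L : Set (Fin r → F)) (L' : Set (Fin r → F)) δ x).Finite ∧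
      Nat.card (countSet v0 v0' (L : Set (Fin r → F)) (L' : Set (Fin r → F)) δ x) =
        ∏ᶠ p : HeightOneSpectrum ↥(integralClosure (Polynomial Fq) F),
          Nat.card (countSet (embVec _ F p v0) (embVec _ F p v0')
            (locCl _ F p (L : Set (Fin r → F))) (locCl _ F p (L' : Set (Fin r → F)))
            (embGL _ F p δ) (embVec _ F p x))) := by
  have : Ring.HasFiniteQuotients ↥(integralClosure (Polynomial Fq) F) :=
    hasFiniteQuotients_integralClosure (Polynomial Fq) (RatFunc Fq) F
  refine ⟨?_, ?_, fun x => ?_⟩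
  · rintro _ γ - - ⟨g, ⟨-, hg⟩, rfl⟩
    change mulGL _ (g * γ) = mulGL _ γ
    rw [mulGL_mul]
    exact congrArg (fun S => mulGL S γ) hg
  · rintro p _ k - - ⟨g, ⟨-, hg⟩, rfl⟩
    change mulGL _ (g * k) = mulGL _ k
    rw [mulGL_mul]
    exact congrArg (fun S => mulGL S k) hg
  have hX' := isLatticeCoset_imDelta hL'fg hL'span v0' 1
  rw [imDelta_one] at hX'
  simp only [finite_countSet_iff, card_countSet, ← locCl_imDelta, ← locCl_cosetOf]
  refine card_orbSet_eq_finprod hr (isLatticeCoset_imDelta hLfg hLspan v0 δ) hX'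
    (fun p => ?_) (fun p k hk => ?_) x
  · rw [locCl_imDelta, locCl_cosetOf]
    exact hA p
  · rw [locCl_imDelta, locCl_cosetOf] at *
    exact exists_det_one_of_lattice hLfg hL'fg hLspan hL'span p (hA p) (hB p) (hC p) hk
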